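/- Let n ≥ 2, let (a_j)_{j∈ℕ} and (b_j)_{j∈ℕ} be tame discrete sequences in ℂⁿ without repetitions, let (m_j)_{j∈ℕ} be natural numbers, and for each j let P_j : ℂⁿ → ℂⁿ be a polynomial map with P_j(0) = 0 whose derivative at 0 is invertible. Then there exists a holomorphic automorphism F of ℂⁿ such that for every j: F(a_j) = b_j and F(z) − b_j − P_j(z − a_j) = O(‖z − a_j‖^{m_j + 1}) as z → a_j. -/

import Mathlib

open Asymptotics Filter

noncomputable section

/-- A holomorphic automorphism of ℂⁿ: a bijective entire map with entire inverse. -/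
def IsHolomorphicAutomorphism {n : ℕ}
    (F : EuclideanSpace ℂ (Fin n) → EuclideanSpace ℂ (Fin n)) : Prop :=
  Differentiable ℂ F ∧ ∃ G : EuclideanSpace ℂ (Fin n) → EuclideanSpace ℂ (Fin n),
    Differentiable ℂ G ∧ (∀ z, G (F z) = z) ∧ (∀ z, F (G z) = z)

/-- A sequence (a_j) of points in ℂⁿ is tame if some holomorphic automorphism Φ of ℂⁿ
sends a_j to (j, 0, …, 0) for every j. -/
def IsTameSequence {n : ℕ} (a : ℕ → EuclideanSpace ℂ (Fin n)) : Prop :=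
  ∃ Φ : EuclideanSpace ℂ (Fin n) → EuclideanSpace ℂ (Fin n),
    IsHolomorphicAutomorphism Φ ∧
    ∀ (j : ℕ) (i : Fin n), Φ (a j) i = if (i : ℕ) = 0 then (j : ℂ) else 0

section Auxiliary

set_option linter.unusedSectionVars false

open Metric Set Topology

section Entire

variable {E F G : Type*} [NormedAddCommGroup E] [NormedSpace ℂ E]
  [NormedAddCommGroup F] [NormedSpace ℂ F] [NormedAddCommGroup G] [NormedSpace ℂ G]

/-- Cauchy's estimate for the Fréchet derivative. -/
lemma norm_fderiv_le_of_norm_le_on_ball {f : E → F} (hf : Differentiable ℂ f) {c : E} {r M : ℝ}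
    (hr : 0 < r) (hM : ∀ z ∈ ball c r, ‖f z‖ ≤ M) : ‖fderiv ℂ f c‖ ≤ 2 * M / r := by
  refine Complex.norm_fderiv_le_div_of_mapsTo_ball hf.differentiableOn (fun z hz => ?_) hr
  rw [mem_closedBall, dist_eq_norm]
  have h1 := hM z hz
  have h2 := hM c (mem_ball_self hr)
  have h3 := norm_sub_le (f z) (f c)
  linarith

/-- Schwarz' lemma at the origin of a ball for maps vanishing to a given order. -/
lemma norm_le_mul_pow_of_isBigO {f : E → F} (hf : Differentiable ℂ f) {c : E} {M : ℝ} {N : ℕ}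
    (hM : ∀ z ∈ ball c 1, ‖f z‖ ≤ M) (hN : f =O[𝓝 c] fun z => ‖z - c‖ ^ (N + 1))
    {z : E} (hz : z ∈ ball c 1) : ‖f z‖ ≤ M * ‖z - c‖ ^ (N + 1) := by
  have h0 : f c = 0 := by
    have := hN.eq_zero_imp.self_of_nhds
    exact this (by simp)
  have hlit : (fun w => f w - f c) =o[𝓝 c] fun w => ‖w - c‖ ^ N := by
    simp only [h0, sub_zero]
    refine hN.trans_isLittleO ?_
    have h1 : (fun w : E => ‖w - c‖) =o[𝓝 c] (fun _ => (1 : ℝ)) := by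
      rw [isLittleO_one_iff]
      have : Continuous fun w : E => ‖w - c‖ := by fun_prop
      simpa using this.tendsto c
    simpa [pow_succ] using (isBigO_refl (fun w : E => ‖w - c‖ ^ N) (𝓝 c)).mul_isLittleO h1
  have := Complex.dist_le_mul_div_pow_of_mapsTo_ball_of_isLittleO (R₂ := M)
    hf.differentiableOn (fun w hw => by simpa [h0] using hM w hw) hlit hz
  simpa [h0, dist_eq_norm] using this

lemma eq_zero_of_isBigO_pow {f : E → F} {c : E} {N : ℕ} (hN0 : N ≠ 0)
    (hN : f =O[𝓝 c] fun z => ‖z - c‖ ^ N) : f c = 0 :=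
  hN.eq_zero_imp.self_of_nhds (by simp [hN0])

lemma isBigO_pow_of_le {c : E} {M N : ℕ} (h : M ≤ N) :
    (fun z => ‖z - c‖ ^ N) =O[𝓝 c] fun z : E => ‖z - c‖ ^ M := by
  refine IsBigO.of_bound 1 ?_
  filter_upwards [ball_mem_nhds c one_pos] with z hz
  rw [mem_ball, dist_eq_norm] at hz
  simpa using pow_le_pow_of_le_one (norm_nonneg _) hz.le h

lemma isBigO_pow_of_le_zero {M N : ℕ} (h : M ≤ N) :
    (fun z => ‖z‖ ^ N) =O[𝓝 0] fun z : E => ‖z‖ ^ M := by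
  simpa using isBigO_pow_of_le (c := (0 : E)) h

/-- The derivative of an entire map vanishing to order `d + 1` vanishes to order `d`. -/
lemma fderiv_isBigO_pow {f : E → F} (hf : Differentiable ℂ f) {d : ℕ}
    (h : f =O[𝓝 0] fun z => ‖z‖ ^ (d + 1)) : fderiv ℂ f =O[𝓝 0] fun z => ‖z‖ ^ d := by
  obtain ⟨C, hC, hb⟩ := h.exists_pos
  obtain ⟨ρ, hρ, hball⟩ := Metric.eventually_nhds_iff_ball.1 hb.bound
  refine IsBigO.of_bound (max (2 * (C * 2 ^ (d + 1))) ‖fderiv ℂ f 0‖) ?_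
  filter_upwards [ball_mem_nhds (0 : E) (half_pos hρ)] with z hz
  rw [mem_ball_zero_iff] at hz
  rcases eq_or_ne z 0 with rfl | hz0
  · rcases Nat.eq_zero_or_pos d with rfl | hd
    · simp
    · have h0 : f 0 = 0 := eq_zero_of_isBigO_pow (N := d + 1) (by simp) (by simpa using h)
      have h3 : HasFDerivAt f (0 : E →L[ℂ] F) 0 := by
        rw [hasFDerivAt_iff_isLittleO_nhds_zero]
        simp only [zero_add, h0, sub_zero, zero_apply]
        refine h.trans_isLittleO ?_
        have : (fun z : E => ‖z‖ ^ (d + 1)) =o[𝓝 0] fun z => ‖z‖ ^ 1 :=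
          (isLittleO_pow_pow (by omega : 1 < d + 1)).comp_tendsto
            (by simpa using (continuous_norm (E := E)).tendsto 0)
        exact (by simpa using this : _ =o[𝓝 0] fun z : E => ‖z‖).of_norm_right
      simp only [h3.fderiv, norm_zero]
      positivity
  · have hzp : 0 < ‖z‖ := norm_pos_iff.2 hz0
    have := norm_fderiv_le_of_norm_le_on_ball hf (c := z) (M := C * (2 * ‖z‖) ^ (d + 1)) hzp
      (fun w hw => by
        rw [mem_ball, dist_eq_norm] at hw
        have hw2 : ‖w‖ ≤ 2 * ‖z‖ := by
          have := norm_add_le (w - z) z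
          simp only [sub_add_cancel] at this
          linarith
        have h1 := hball w (by rw [mem_ball_zero_iff]; linarith)
        simp only [norm_pow, norm_norm] at h1
        exact h1.trans (by gcongr))
    calc ‖fderiv ℂ f z‖ ≤ _ := this
      _ = 2 * (C * 2 ^ (d + 1)) * ‖z‖ ^ d := by
        field_simp
        ring
      _ ≤ _ := by
        rw [norm_pow, norm_norm]
        gcongr
        exact le_max_left _ _

/-- Lipschitz-type estimate for an entire map vanishing to order `d + 1` at the origin. -/
lemma comp_sub_comp_isBigO {H : Type*} [NormedAddCommGroup H] {K : E → F}
    (hK : Differentiable ℂ K) {d e : ℕ}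
    (hKd : K =O[𝓝 0] fun z => ‖z‖ ^ (d + 1)) {u v : H → E}
    (hu : u =O[𝓝 0] fun z => ‖z‖) (hv : v =O[𝓝 0] fun z => ‖z‖)
    (huv : (fun z => u z - v z) =O[𝓝 0] fun z => ‖z‖ ^ e) :
    (fun z => K (u z) - K (v z)) =O[𝓝 0] fun z => ‖z‖ ^ (d + e) := by
  obtain ⟨C, hC, hb⟩ := (fderiv_isBigO_pow hK hKd).exists_pos
  obtain ⟨ρ, hρ, hball⟩ := Metric.eventually_nhds_iff_ball.1 hb.bound
  obtain ⟨Cu, hCu, hbu⟩ := hu.exists_pos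
  obtain ⟨Cv, hCv, hbv⟩ := hv.exists_pos
  obtain ⟨D, hD, hbD⟩ := huv.exists_pos
  have hrad : ∀ᶠ z : H in 𝓝 0, (Cu + Cv) * ‖z‖ < ρ := by
    have : Continuous fun z : H => (Cu + Cv) * ‖z‖ := by fun_prop
    exact this.tendsto' 0 0 (by simp) |>.eventually (gt_mem_nhds hρ)
  refine IsBigO.of_bound (C * (Cu + Cv) ^ d * D) ?_
  filter_upwards [hbu.bound, hbv.bound, hbD.bound, hrad] with z h1 h2 h3 h4
  simp only [norm_pow, norm_norm] at h1 h2 h3 ⊢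
  have hmem : ∀ x ∈ closedBall (0 : E) ((Cu + Cv) * ‖z‖),
      ‖fderiv ℂ K x‖ ≤ C * ((Cu + Cv) * ‖z‖) ^ d := by
    intro x hx
    rw [mem_closedBall_zero_iff] at hx
    have := hball x (by rw [mem_ball_zero_iff]; linarith)
    simp only [norm_pow, norm_norm] at this
    exact this.trans (by gcongr)
  have key := (convex_closedBall (0 : E) ((Cu + Cv) * ‖z‖)).norm_image_sub_le_of_norm_fderiv_le
    (𝕜 := ℂ) (fun x _ => hK x) hmem (x := v z) (y := u z)
    (by rw [mem_closedBall_zero_iff]; nlinarith [norm_nonneg z])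
    (by rw [mem_closedBall_zero_iff]; nlinarith [norm_nonneg z])
  calc _ ≤ _ := key
    _ ≤ C * ((Cu + Cv) * ‖z‖) ^ d * (D * ‖z‖ ^ e) := by gcongr
    _ = _ := by
      rw [mul_pow, pow_add]
      ring

/-- Entire maps are locally Lipschitz. -/
lemma sub_isBigO_sub {f : E → F} (hf : Differentiable ℂ f) {H : Type*} {l : Filter H}
    {u v : H → E} {c : E} (hu : Tendsto u l (𝓝 c)) (hv : Tendsto v l (𝓝 c)) :
    (fun z => f (u z) - f (v z)) =O[l] fun z => u z - v z := by
  obtain ⟨ρ, hρ, hball⟩ := Metric.eventually_nhds_iff_ball.1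
    (hf.continuous.norm.tendsto c |>.eventually (gt_mem_nhds (lt_add_one ‖f c‖)))
  have hd : ∀ x ∈ ball c (ρ / 2), ‖fderiv ℂ f x‖ ≤ 2 * (‖f c‖ + 1) / (ρ / 2) := fun x hx =>
    norm_fderiv_le_of_norm_le_on_ball hf (half_pos hρ) fun z hz =>
      (hball z (by
        rw [mem_ball] at *
        have := dist_triangle z x c
        linarith)).le
  refine IsBigO.of_bound (2 * (‖f c‖ + 1) / (ρ / 2)) ?_
  filter_upwards [hu (ball_mem_nhds c (half_pos hρ)), hv (ball_mem_nhds c (half_pos hρ))]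
    with z h1 h2
  exact (convex_ball c (ρ / 2)).norm_image_sub_le_of_norm_fderiv_le (𝕜 := ℂ)
    (fun x _ => hf x) hd h2 h1

lemma sub_isBigO_norm_sub {f : E → F} (hf : Differentiable ℂ f) (c : E) :
    (fun z => f z - f c) =O[𝓝 c] fun z => ‖z - c‖ :=
  (sub_isBigO_sub hf tendsto_id tendsto_const_nhds).norm_right

/-- Second order Taylor estimate. -/
lemma sub_fderiv_isBigO {f : E → F} (hf : Differentiable ℂ f) :
    (fun z => f z - f 0 - fderiv ℂ f 0 z) =O[𝓝 0] fun z => ‖z‖ ^ 2 := by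
  set g : E → F := fun z => f z - f 0 - fderiv ℂ f 0 z with hg
  have hgd : Differentiable ℂ g := by fun_prop
  obtain ⟨ρ, hρ, hball⟩ := Metric.eventually_nhds_iff_ball.1
    (hgd.continuous.norm.tendsto 0 |>.eventually (gt_mem_nhds (lt_add_one ‖g 0‖)))
  have g0 : g 0 = 0 := by simp [hg]
  have hlit : (fun w => g w - g 0) =o[𝓝 0] fun w => ‖w - 0‖ ^ 1 := by
    have := (hasFDerivAt_iff_isLittleO_nhds_zero.1 (hf 0).hasFDerivAt)
    simpa [hg] using this.norm_right
  refine IsBigO.of_bound (1 / ρ ^ 2) ?_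
  filter_upwards [ball_mem_nhds (0 : E) hρ] with z hz
  have := Complex.dist_le_mul_div_pow_of_mapsTo_ball_of_isLittleO (R₂ := 1)
    hgd.differentiableOn (fun w hw => by simpa [g0] using (hball w hw).le) hlit hz
  simp only [g0, dist_zero_right] at this
  rw [norm_pow, norm_norm]
  calc ‖g z‖ ≤ _ := this
    _ = _ := by ring

/-- Locally uniform limits of entire maps are entire. -/
lemma differentiable_of_tendstoUniformlyOn_closedBall [CompleteSpace F] {f : ℕ → E → F}
    {g : E → F} (hf : ∀ n, Differentiable ℂ (f n))
    (h : ∀ R : ℝ, TendstoUniformlyOn f g atTop (closedBall 0 R)) : Differentiable ℂ g := by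
  have hcauchy : ∀ R : ℝ, UniformCauchySeqOn (fun n => fderiv ℂ (f n)) atTop (closedBall 0 R) := by
    intro R
    rw [Metric.uniformCauchySeqOn_iff]
    intro ε hε
    obtain ⟨N, hN⟩ := Metric.uniformCauchySeqOn_iff.1 (h (R + 1)).uniformCauchySeqOn (ε / 4)
      (by positivity)
    refine ⟨N, fun m hm n hn x hx => ?_⟩
    rw [dist_eq_norm, ← fderiv_sub (hf m x) (hf n x)]
    have := norm_fderiv_le_of_norm_le_on_ball ((hf m).sub (hf n)) (c := x) (M := ε / 4) one_pos
      (fun z hz => by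
        have := hN m hm n hn z (by
          rw [mem_closedBall, dist_zero_right] at *
          rw [mem_ball, dist_eq_norm] at hz
          have := norm_add_le (z - x) x
          simp only [sub_add_cancel] at this
          linarith)
        rw [dist_eq_norm] at this
        exact this.le)
    refine this.trans_lt ?_
    linarith
  have hlim : ∀ x, ∃ L, Tendsto (fun n => fderiv ℂ (f n) x) atTop (𝓝 L) := fun x =>
    cauchySeq_tendsto_of_complete ((hcauchy ‖x‖).cauchySeq (by simp))
  choose g' hg' using hlim
  intro x
  refine (hasFDerivAt_of_tendstoUniformlyOn (𝕜 := ℂ) (f := f) (f' := fun n => fderiv ℂ (f n))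
    (g' := g') (g := g) (l := atTop) (s := ball 0 (‖x‖ + 1)) isOpen_ball ?_
    (fun n y _ => (hf n y).hasFDerivAt) (fun y _ => (h ‖y‖).tendsto_at (by simp))
    (by simp)).differentiableAt
  exact ((hcauchy (‖x‖ + 1)).tendstoUniformlyOn_of_tendsto fun y _ => hg' y).mono
    ball_subset_closedBall

lemma exists_norm_le_on_closedBall [ProperSpace E] {f : E → F} (hf : Continuous f) (R : ℝ) :
    ∃ M, 0 < M ∧ ∀ z ∈ closedBall (0 : E) R, ‖f z‖ ≤ M := by
  obtain ⟨M, hM⟩ := (isCompact_closedBall (0 : E) R).exists_bound_of_continuousOn hf.continuousOn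
  exact ⟨max M 1, by positivity, fun z hz => (hM z hz).trans (le_max_left _ _)⟩

/-- Directional derivatives of entire maps are entire. -/
lemma differentiable_fderiv_apply [ProperSpace E] [CompleteSpace F] {f : E → F}
    (hf : Differentiable ℂ f) (v : E) : Differentiable ℂ fun z => fderiv ℂ f z v := by
  refine differentiable_of_tendstoUniformlyOn_closedBall
    (f := fun n z => ((n : ℂ) + 1) • (f (z + ((n : ℂ) + 1)⁻¹ • v) - f z)) (fun n => by fun_prop) ?_
  intro R
  obtain ⟨M, hM, hMb⟩ := exists_norm_le_on_closedBall hf.continuous (R + 2)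
  rw [Metric.tendstoUniformlyOn_iff]
  intro ε hε
  have hn : Tendsto (fun n : ℕ => ((n : ℝ) + 1)⁻¹) atTop (𝓝 0) := by
    simpa using tendsto_one_div_add_atTop_nhds_zero_nat (𝕜 := ℝ)
  have h1 : ∀ᶠ n : ℕ in atTop, ((n : ℝ) + 1)⁻¹ * ‖v‖ < 1 :=
    ((hn.mul_const ‖v‖).congr fun _ => rfl).eventually (gt_mem_nhds (by simp))
  have h2 : ∀ᶠ n : ℕ in atTop, ((n : ℝ) + 1)⁻¹ * (4 * M * ‖v‖ ^ 2) < ε :=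
    ((hn.mul_const (4 * M * ‖v‖ ^ 2)).congr fun _ => rfl).eventually
      (gt_mem_nhds (by simpa using hε))
  filter_upwards [h1, h2] with n h1 h2 z hz
  rw [mem_closedBall_zero_iff] at hz
  set g : E → F := fun w => f (z + w) - f z - fderiv ℂ f z w with hg
  have hgd : Differentiable ℂ g := by fun_prop
  have g0 : g 0 = 0 := by simp [hg]
  have hb : ∀ w ∈ ball (0 : E) 1, ‖f (z + w)‖ ≤ M := fun w hw => hMb _ (by
    rw [mem_ball_zero_iff] at hw
    rw [mem_closedBall_zero_iff]
    linarith [norm_add_le z w])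
  have hder : ‖fderiv ℂ f z‖ ≤ 2 * M / 1 :=
    norm_fderiv_le_of_norm_le_on_ball hf one_pos fun w hw => by
      have := hb (w - z) (by simpa [dist_eq_norm] using hw)
      simpa using this
  have hgM : ∀ w ∈ ball (0 : E) 1, ‖g w‖ ≤ 4 * M := by
    intro w hw
    have e1 := hb w hw
    have e2 := hb 0 (by simp)
    rw [add_zero] at e2
    have e3 : ‖fderiv ℂ f z w‖ ≤ 2 * M := by
      rw [mem_ball_zero_iff] at hw
      calc _ ≤ ‖fderiv ℂ f z‖ * ‖w‖ := ContinuousLinearMap.le_opNorm _ _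
        _ ≤ 2 * M / 1 * 1 := by gcongr
        _ = _ := by ring
    calc ‖g w‖ ≤ ‖f (z + w) - f z‖ + ‖fderiv ℂ f z w‖ := norm_sub_le _ _
      _ ≤ ‖f (z + w)‖ + ‖f z‖ + ‖fderiv ℂ f z w‖ := by gcongr; exact norm_sub_le _ _
      _ ≤ _ := by linarith
  have hg2 : g =O[𝓝 0] fun w => ‖w - 0‖ ^ (1 + 1) := by
    have hsh : Differentiable ℂ fun w => f (z + w) := by fun_prop
    have := sub_fderiv_isBigO hsh
    simpa [hg, fderiv_comp_add_left] using this
  have hpos : (0 : ℝ) < (n : ℝ) + 1 := by positivity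
  have hnorm : ‖((n : ℂ) + 1)‖ = (n : ℝ) + 1 := by
    have : ((n : ℂ) + 1) = ((n + 1 : ℕ) : ℂ) := by push_cast; rfl
    rw [this, Complex.norm_natCast]; push_cast; rfl
  have hw : ‖((n : ℂ) + 1)⁻¹ • v‖ = ((n : ℝ) + 1)⁻¹ * ‖v‖ := by
    rw [norm_smul, norm_inv, hnorm]
  have hne : ((n : ℂ) + 1) ≠ 0 := by
    rw [← norm_pos_iff, hnorm]; exact hpos
  have key := norm_le_mul_pow_of_isBigO hgd hgM hg2 (z := ((n : ℂ) + 1)⁻¹ • v)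
    (by rw [mem_ball_zero_iff, hw]; exact h1)
  have heq : ((n : ℂ) + 1) • (f (z + ((n : ℂ) + 1)⁻¹ • v) - f z) - fderiv ℂ f z v
      = ((n : ℂ) + 1) • g (((n : ℂ) + 1)⁻¹ • v) := by
    simp only [hg, smul_sub, map_smul, smul_smul, mul_inv_cancel₀ hne, one_smul]
  rw [dist_comm, dist_eq_norm, heq, norm_smul, hnorm]
  calc _ ≤ ((n : ℝ) + 1) * (4 * M * ‖((n : ℂ) + 1)⁻¹ • v - 0‖ ^ (1 + 1)) := by gcongr
    _ = ((n : ℝ) + 1)⁻¹ * (4 * M * ‖v‖ ^ 2) := by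
      have : ((n : ℝ) + 1) * (((n : ℝ) + 1)⁻¹) ^ 2 = ((n : ℝ) + 1)⁻¹ := by field_simp
      rw [sub_zero, hw]
      linear_combination (4 * M * ‖v‖ ^ 2) * this
    _ < ε := h2

/-- If entire maps with a given vanishing order at `c` converge uniformly on bounded sets, then
the limit has the same vanishing order. -/
lemma isBigO_pow_of_tendstoUniformlyOn [ProperSpace E] {f : ℕ → E → F} {g : E → F}
    (hf : ∀ n, Differentiable ℂ (f n)) (hg : Continuous g)
    (h : ∀ R : ℝ, TendstoUniformlyOn f g atTop (closedBall 0 R)) {c : E} {N : ℕ}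
    (hN : ∀ᶠ n in atTop, f n =O[𝓝 c] fun z => ‖z - c‖ ^ (N + 1)) :
    g =O[𝓝 c] fun z => ‖z - c‖ ^ (N + 1) := by
  obtain ⟨M, hM, hMb⟩ := exists_norm_le_on_closedBall hg (‖c‖ + 1)
  have hev := (Metric.tendstoUniformlyOn_iff.1 (h (‖c‖ + 1))) 1 one_pos
  refine IsBigO.of_bound (M + 1) ?_
  filter_upwards [ball_mem_nhds c one_pos] with z hz
  have hsub : ball c 1 ⊆ closedBall (0 : E) (‖c‖ + 1) := fun w hw => by
    rw [mem_closedBall_zero_iff]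
    rw [mem_ball, dist_eq_norm] at hw
    have := norm_add_le (w - c) c
    simp only [sub_add_cancel] at this
    linarith
  have hlim : Tendsto (fun n => ‖f n z‖) atTop (𝓝 ‖g z‖) :=
    ((h (‖c‖ + 1)).tendsto_at (hsub hz)).norm
  rw [norm_pow, norm_norm]
  refine le_of_tendsto hlim ?_
  filter_upwards [hN, hev] with n h1 h2
  refine norm_le_mul_pow_of_isBigO (hf n) (fun w hw => ?_) h1 hz
  have e1 := h2 w (hsub hw)
  have e2 := hMb w (hsub hw)
  rw [dist_comm, dist_eq_norm] at e1
  have := norm_add_le (f n w - g w) (g w)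
  simp only [sub_add_cancel] at this
  linarith

end Entire

/-! ### Jets -/

section Jets

variable {E : Type*} [NormedAddCommGroup E] [NormedSpace ℂ E]

/-- `f` and `g` agree to order `N` (exclusive) at `c`. -/
def JetEq (N : ℕ) (c : E) (f g : E → E) : Prop :=
  (fun z => f z - g z) =O[𝓝 c] fun z => ‖z - c‖ ^ N

lemma JetEq.refl (N : ℕ) (c : E) (f : E → E) : JetEq N c f f := by
  simp [JetEq, isBigO_zero]

lemma JetEq.symm {N : ℕ} {c : E} {f g : E → E} (h : JetEq N c f g) : JetEq N c g f := by
  unfold JetEq at *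
  simpa using h.neg_left

lemma JetEq.trans {N : ℕ} {c : E} {f g h : E → E} (h₁ : JetEq N c f g) (h₂ : JetEq N c g h) :
    JetEq N c f h := by
  unfold JetEq at *
  simpa using h₁.add h₂

lemma JetEq.mono {M N : ℕ} {c : E} {f g : E → E} (h : JetEq N c f g) (hMN : M ≤ N) :
    JetEq M c f g :=
  IsBigO.trans h (isBigO_pow_of_le hMN)

lemma JetEq.eq {N : ℕ} {c : E} {f g : E → E} (h : JetEq (N + 1) c f g) : f c = g c :=
  sub_eq_zero.1 (eq_zero_of_isBigO_pow (f := fun z => f z - g z) N.succ_ne_zero h)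

lemma JetEq.comp {N : ℕ} {c d : E} {f₁ g₁ f₂ g₂ : E → E} (h₂ : JetEq (N + 1) d f₂ g₂)
    (h₁ : JetEq (N + 1) c f₁ g₁) (hd : f₁ c = d)
    (hf₁ : Differentiable ℂ f₁) (hg₁ : Differentiable ℂ g₁) (hg₂ : Differentiable ℂ g₂) :
    JetEq (N + 1) c (fun z => f₂ (f₁ z)) (fun z => g₂ (g₁ z)) := by
  have hgc : g₁ c = d := h₁.eq ▸ hd
  have t1 : Tendsto f₁ (𝓝 c) (𝓝 d) := hd ▸ hf₁.continuous.tendsto c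
  have t2 : Tendsto g₁ (𝓝 c) (𝓝 d) := hgc ▸ hg₁.continuous.tendsto c
  have e1 : (fun z => f₂ (f₁ z) - g₂ (f₁ z)) =O[𝓝 c] fun z => ‖z - c‖ ^ (N + 1) := by
    refine (IsBigO.comp_tendsto h₂ t1).trans ?_
    have := (sub_isBigO_norm_sub hf₁ c).norm_left.pow (N + 1)
    simpa [Function.comp_def, hd] using this
  have e2 : (fun z => g₂ (f₁ z) - g₂ (g₁ z)) =O[𝓝 c] fun z => ‖z - c‖ ^ (N + 1) :=
    (sub_isBigO_sub hg₂ t1 t2).trans h₁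
  simpa [JetEq] using e1.add e2

end Jets

/-! ### Homogeneous polynomials -/

section Homogeneous

variable {n : ℕ}

/-- The monomial `z ↦ z ^ α` on `ℂⁿ`. -/
def monomialFun (α : Fin n → ℕ) (z : EuclideanSpace ℂ (Fin n)) : ℂ := ∏ i, z i ^ α i

/-- Homogeneous polynomial functions of degree `d` on `ℂⁿ`. -/
def HomPoly (n d : ℕ) : Submodule ℂ (EuclideanSpace ℂ (Fin n) → ℂ) :=
  Submodule.span ℂ {f | ∃ α : Fin n → ℕ, ∑ i, α i = d ∧ f = monomialFun α}

lemma monomialFun_mem_homPoly {α : Fin n → ℕ} {d : ℕ} (h : ∑ i, α i = d) :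
    monomialFun α ∈ HomPoly n d :=
  Submodule.subset_span ⟨α, h, rfl⟩

lemma differentiable_coord (i : Fin n) :
    Differentiable ℂ fun z : EuclideanSpace ℂ (Fin n) => z i :=
  (EuclideanSpace.proj (𝕜 := ℂ) i).differentiable

lemma differentiable_monomialFun (α : Fin n → ℕ) : Differentiable ℂ (monomialFun α) := by
  unfold monomialFun
  fun_prop

lemma monomialFun_smul (α : Fin n → ℕ) (t : ℂ) (z : EuclideanSpace ℂ (Fin n)) :
    monomialFun α (t • z) = t ^ (∑ i, α i) * monomialFun α z := by
  simp only [monomialFun, PiLp.smul_apply, smul_eq_mul, mul_pow, Finset.prod_mul_distrib,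
    Finset.prod_pow_eq_pow_sum]

lemma apply_smul_of_mem_homPoly {d : ℕ} {K : EuclideanSpace ℂ (Fin n) → ℂ}
    (hK : K ∈ HomPoly n d) (t : ℂ) (z : EuclideanSpace ℂ (Fin n)) : K (t • z) = t ^ d * K z := by
  induction hK using Submodule.span_induction with
  | mem x hx =>
    obtain ⟨α, rfl, rfl⟩ := hx
    exact monomialFun_smul α t z
  | zero => simp
  | add x y _ _ hx hy => simp only [Pi.add_apply, hx, hy, mul_add]
  | smul a x _ hx =>
    simp only [Pi.smul_apply, hx, smul_eq_mul]
    ring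

lemma coord_mul_monomialFun (i : Fin n) (α : Fin n → ℕ) :
    (fun z => z i * monomialFun α z) = monomialFun (α + Pi.single i 1) := by
  funext z
  simp only [monomialFun, Pi.add_apply, pow_add, Finset.prod_mul_distrib]
  rw [mul_comm, Finset.prod_eq_single (f := fun j => z j ^ (Pi.single i 1 : Fin n → ℕ) j) i]
  · simp
  · intro j _ hj
    simp [hj]
  · simp

lemma coord_mul_mem_homPoly {d : ℕ} {K : EuclideanSpace ℂ (Fin n) → ℂ}
    (hK : K ∈ HomPoly n d) (i : Fin n) : (fun z => z i * K z) ∈ HomPoly n (d + 1) := by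
  induction hK using Submodule.span_induction with
  | mem x hx =>
    obtain ⟨α, rfl, rfl⟩ := hx
    rw [coord_mul_monomialFun]
    exact monomialFun_mem_homPoly (by simp [Finset.sum_add_distrib])
  | zero =>
    convert (HomPoly n (d + 1)).zero_mem using 1
    funext z
    simp
  | add x y _ _ hx hy =>
    convert (HomPoly n (d + 1)).add_mem hx hy using 1
    funext z
    simp [mul_add]
  | smul a x _ hx =>
    convert (HomPoly n (d + 1)).smul_mem a hx using 1
    funext z
    simp only [Pi.smul_apply, smul_eq_mul]
    ring

lemma clm_apply_eq_sum {F : Type*} [NormedAddCommGroup F] [NormedSpace ℂ F]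
    (A : EuclideanSpace ℂ (Fin n) →L[ℂ] F) (z : EuclideanSpace ℂ (Fin n)) :
    A z = ∑ i, z i • A (EuclideanSpace.single i 1) := by
  conv_lhs => rw [← (EuclideanSpace.basisFun (Fin n) ℂ).sum_repr z]
  simp

/-- The leading homogeneous part of an entire function. -/
lemma exists_homPoly_sub_isBigO (d : ℕ) {f : EuclideanSpace ℂ (Fin n) → ℂ}
    (hf : Differentiable ℂ f) (hd : f =O[𝓝 0] fun z => ‖z‖ ^ d) :
    ∃ K ∈ HomPoly n d, (fun z => f z - K z) =O[𝓝 0] fun z => ‖z‖ ^ (d + 1) := by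
  induction d generalizing f with
  | zero =>
    refine ⟨fun _ => f 0, ?_, by simpa using sub_isBigO_norm_sub hf 0⟩
    convert (HomPoly n 0).smul_mem (f 0) (monomialFun_mem_homPoly (α := 0) (by simp)) using 1
    funext z
    simp [monomialFun]
  | succ d ih =>
    have hder := fderiv_isBigO_pow hf hd
    have hpart : ∀ i : Fin n, ∃ K ∈ HomPoly n d,
        (fun z => fderiv ℂ f z (EuclideanSpace.single i 1) - K z) =O[𝓝 0]
          fun z => ‖z‖ ^ (d + 1) := fun i =>
      ih (differentiable_fderiv_apply hf _) <|
        (IsBigO.of_bound ‖EuclideanSpace.single i (1 : ℂ)‖ (Eventually.of_forall fun z => by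
          rw [mul_comm]; exact ContinuousLinearMap.le_opNorm _ _)).trans hder
    choose K hK hKO using hpart
    set L : EuclideanSpace ℂ (Fin n) → ℂ := fun z => ((d : ℂ) + 1)⁻¹ * ∑ i, z i * K i z with hL
    have hne : ((d : ℂ) + 1) ≠ 0 := by exact_mod_cast d.succ_ne_zero
    have hLmem : L ∈ HomPoly n (d + 1) := by
      convert (HomPoly n (d + 1)).smul_mem ((d : ℂ) + 1)⁻¹
        (Submodule.sum_mem _ fun i (_ : i ∈ Finset.univ) => coord_mul_mem_homPoly (hK i) i) using 1
      funext z
      simp [hL]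
    refine ⟨L, hLmem, ?_⟩
    have hsum : (fun z => ∑ i, ‖fderiv ℂ f z (EuclideanSpace.single i 1) - K i z‖) =O[𝓝 0]
        fun z => ‖z‖ ^ (d + 1) := IsBigO.fun_sum fun i _ => (hKO i).norm_left
    obtain ⟨C, hC, hb⟩ := hsum.exists_pos
    obtain ⟨ρ, hρ, hball⟩ := Metric.eventually_nhds_iff_ball.1 hb.bound
    refine IsBigO.of_bound C ?_
    filter_upwards [ball_mem_nhds 0 hρ] with z hz
    rw [mem_ball_zero_iff] at hz
    have hder' : ∀ t : ℂ, HasDerivAt (fun t : ℂ => f (t • z) - t ^ (d + 1) * L z)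
        (∑ i, z i * (fderiv ℂ f (t • z) (EuclideanSpace.single i 1) - K i (t • z))) t := by
      intro t
      have h1 : HasDerivAt (fun t : ℂ => f (t • z)) (fderiv ℂ f (t • z) z) t := by
        have : HasDerivAt (fun t : ℂ => t • z) z t := by
          simpa using (hasDerivAt_id t).smul_const z
        exact (hf (t • z)).hasFDerivAt.comp_hasDerivAt t this
      have h2 : HasDerivAt (fun t : ℂ => t ^ (d + 1) * L z) (((d : ℂ) + 1) * t ^ d * L z) t := by
        simpa using (hasDerivAt_pow (d + 1) t).mul_const (L z)
      refine (h1.fun_sub h2).congr_deriv ?_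
      have h4 : ((d : ℂ) + 1) * t ^ d * L z = ∑ i, z i * K i (t • z) := by
        simp only [hL, apply_smul_of_mem_homPoly (hK _)]
        rw [show ((d : ℂ) + 1) * t ^ d * (((d : ℂ) + 1)⁻¹ * ∑ i, z i * K i z)
          = t ^ d * ∑ i, z i * K i z by field_simp, Finset.mul_sum]
        exact Finset.sum_congr rfl fun i _ => by ring
      rw [clm_apply_eq_sum, h4, ← Finset.sum_sub_distrib]
      exact Finset.sum_congr rfl fun i _ => by rw [smul_eq_mul]; ring
    have hbound : ∀ t ∈ closedBall (0 : ℂ) 1,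
        ‖∑ i, z i * (fderiv ℂ f (t • z) (EuclideanSpace.single i 1) - K i (t • z))‖
          ≤ C * ‖z‖ ^ (d + 2) := by
      intro t ht
      rw [mem_closedBall_zero_iff] at ht
      have htz : ‖t • z‖ ≤ ‖z‖ := by
        rw [norm_smul]; exact mul_le_of_le_one_left (norm_nonneg _) ht
      have h5 := hball (t • z) (by rw [mem_ball_zero_iff]; linarith)
      rw [norm_pow, norm_norm, Real.norm_of_nonneg (by positivity)] at h5
      calc _ ≤ ∑ i, ‖z i * (fderiv ℂ f (t • z) (EuclideanSpace.single i 1) - K i (t • z))‖ :=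
            norm_sum_le _ _
        _ ≤ ∑ i, ‖z‖ * ‖fderiv ℂ f (t • z) (EuclideanSpace.single i 1) - K i (t • z)‖ := by
            gcongr with i
            rw [norm_mul]
            gcongr
            exact PiLp.norm_apply_le z i
        _ = ‖z‖ * ∑ i, ‖fderiv ℂ f (t • z) (EuclideanSpace.single i 1) - K i (t • z)‖ := by
            rw [Finset.mul_sum]
        _ ≤ ‖z‖ * (C * ‖z‖ ^ (d + 1)) := by
            gcongr
            exact h5.trans (by gcongr)
        _ = _ := by ring
    have key := (convex_closedBall (0 : ℂ) 1).norm_image_sub_le_of_norm_hasDerivWithin_le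
      (fun t _ => (hder' t).hasDerivWithinAt) hbound (x := 0) (y := 1) (by simp) (by simp)
    have hf0 : f 0 = 0 := eq_zero_of_isBigO_pow d.succ_ne_zero (by simpa using hd)
    simpa [hf0] using key

end Homogeneous

/-! ### Interpolation by small entire functions -/

section Interpolation

lemma exists_entire_vanishing_at_nat_ne (κ : ℕ) : ∃ u : ℂ → ℂ, Differentiable ℂ u ∧ u κ ≠ 0 ∧
    ∀ j : ℕ, j ≠ κ → u j = 0 := by
  have hs : Differentiable ℂ fun ζ : ℂ => Complex.sin (ζ * Real.pi) := by fun_prop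
  refine ⟨dslope (fun ζ : ℂ => Complex.sin (ζ * Real.pi)) κ, ?_, ?_, fun j hj => ?_⟩
  · rw [← differentiableOn_univ, Complex.differentiableOn_dslope univ_mem]
    exact hs.differentiableOn
  · have hd : HasDerivAt (fun ζ : ℂ => Complex.sin (ζ * Real.pi))
        (Complex.cos (κ * Real.pi) * Real.pi) κ := by
      simpa using ((hasDerivAt_id (κ : ℂ)).mul_const (Real.pi : ℂ)).csin
    rw [dslope_same, hd.deriv]
    refine mul_ne_zero (fun h => ?_) (by exact_mod_cast Real.pi_ne_zero)
    have := Complex.sin_sq_add_cos_sq (κ * Real.pi)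
    simp [h, Complex.sin_nat_mul_pi] at this
  · rw [dslope_of_ne _ (by exact_mod_cast hj), slope_def_field]
    simp [Complex.sin_nat_mul_pi]

/-- There are entire functions, small on a disc, whose jets at the natural numbers are those
of the indicator function of a given point outside the disc. -/
lemma exists_entire_jet_indicator {κ : ℕ} {r : ℝ} (hr : 0 ≤ r) (hrκ : r < κ) (N : ℕ) {δ : ℝ}
    (hδ : 0 < δ) : ∃ f : ℂ → ℂ, Differentiable ℂ f ∧ (∀ ζ ∈ closedBall (0 : ℂ) r, ‖f ζ‖ ≤ δ) ∧
      (∀ j : ℕ, j ≠ κ → f =O[𝓝 (j : ℂ)] fun ζ => ‖ζ - j‖ ^ (N + 1)) ∧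
      (fun ζ => f ζ - 1) =O[𝓝 (κ : ℂ)] fun ζ => ‖ζ - κ‖ ^ (N + 1) := by
  obtain ⟨u, hu, huκ, huj⟩ := exists_entire_vanishing_at_nat_ne κ
  set φ : ℂ → ℂ := fun x => 1 - (1 - x) ^ (N + 1) with hφ
  have hφd : Differentiable ℂ φ := by fun_prop
  have hφ0 : φ 0 = 0 := by simp [hφ]
  have hκ : (κ : ℂ) ≠ 0 := by
    have : (0 : ℝ) < κ := hr.trans_lt hrκ
    exact_mod_cast this.ne'
  obtain ⟨η, hη, hball⟩ := Metric.eventually_nhds_iff_ball.1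
    (hφd.continuous.norm.tendsto 0 |>.eventually (gt_mem_nhds (by simpa [hφ0] using hδ)))
  obtain ⟨M, hM, hMb⟩ := exists_norm_le_on_closedBall hu.continuous r
  have hlim : Tendsto (fun L : ℕ => (M / ‖u κ‖) ^ (N + 1) * (r / κ) ^ L) atTop (𝓝 0) := by
    simpa using (tendsto_pow_atTop_nhds_zero_of_lt_one (by positivity)
      ((div_lt_one (hr.trans_lt hrκ)).2 hrκ)).const_mul ((M / ‖u κ‖) ^ (N + 1))
  obtain ⟨L, hL⟩ := (hlim.eventually (gt_mem_nhds hη)).exists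
  set w : ℂ → ℂ := fun ζ => (u ζ / u κ) ^ (N + 1) * (ζ / κ) ^ L with hw
  have hwd : Differentiable ℂ w := by fun_prop (disch := assumption)
  refine ⟨fun ζ => φ (w ζ), hφd.comp hwd, fun ζ hζ => ?_, fun j hj => ?_, ?_⟩
  · refine (hball _ ?_).le
    rw [mem_ball_zero_iff]
    have h1 := hMb ζ hζ
    rw [mem_closedBall_zero_iff] at hζ
    calc ‖w ζ‖ = (‖u ζ‖ / ‖u κ‖) ^ (N + 1) * (‖ζ‖ / κ) ^ L := by simp [hw]
      _ ≤ (M / ‖u κ‖) ^ (N + 1) * (r / κ) ^ L := by gcongr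
      _ < η := hL
  · have hwj : w j = 0 := by simp [hw, huj j hj]
    have h1 : (fun ζ => φ (w ζ) - φ 0) =O[𝓝 (j : ℂ)] fun ζ => w ζ - 0 :=
      sub_isBigO_sub hφd (hwj ▸ hwd.continuous.tendsto _) tendsto_const_nhds
    simp only [hφ0, sub_zero] at h1
    refine h1.trans ?_
    have h2 : (fun ζ => u ζ / u κ) =O[𝓝 (j : ℂ)] fun ζ => ‖ζ - j‖ := by
      simpa [huj j hj] using sub_isBigO_norm_sub (hu.div_const (u κ)) (j : ℂ)
    have h3 : (fun ζ : ℂ => (ζ / κ) ^ L) =O[𝓝 (j : ℂ)] fun _ => (1 : ℝ) :=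
      (Continuous.tendsto (by fun_prop) _).isBigO_one ℝ
    simpa using (h2.pow (N + 1)).mul h3
  · have hwκ : w κ = 1 := by simp [hw, huκ, hκ]
    have h1 := (sub_isBigO_norm_sub hwd (κ : ℂ)).neg_left.pow (N + 1)
    simpa [hwκ, hφ] using h1.neg_left

end Interpolation

/-! ### Jets realizable by automorphisms close to the identity -/

section Realizable

variable {E : Type*} [NormedAddCommGroup E] [NormedSpace ℂ E]

/-- `F` and `G` are mutually inverse entire maps. -/
structure IsAutPair (F G : E → E) : Prop where
  left : Differentiable ℂ F
  right : Differentiable ℂ G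
  right_left : ∀ z, G (F z) = z
  left_right : ∀ z, F (G z) = z

lemma IsAutPair.refl : IsAutPair (fun z : E => z) fun z => z :=
  ⟨differentiable_id, differentiable_id, fun _ => rfl, fun _ => rfl⟩

lemma IsAutPair.symm {F G : E → E} (h : IsAutPair F G) : IsAutPair G F :=
  ⟨h.right, h.left, h.left_right, h.right_left⟩

lemma IsAutPair.comp {F₁ G₁ F₂ G₂ : E → E} (h₂ : IsAutPair F₂ G₂) (h₁ : IsAutPair F₁ G₁) :
    IsAutPair (fun z => F₂ (F₁ z)) fun z => G₁ (G₂ z) :=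
  ⟨h₂.left.comp h₁.left, h₁.right.comp h₂.right,
    fun z => by rw [h₂.right_left, h₁.right_left], fun z => by rw [h₁.left_right, h₂.left_right]⟩

/-- A map `h` fixing the origin is realizable at `p k` if automorphisms arbitrarily close to the
identity on balls of radius less than `R` have the jet of `h` at `p k` and the jet of the identity
at all other points of the sequence `p`, to any finite order. -/
structure IsRealizable (p : ℕ → E) (k : ℕ) (R : ℝ) (h : E → E) : Prop where
  differentiable : Differentiable ℂ h
  map_zero : h 0 = 0
  exists_aut : ∀ R' < R, ∀ ε > 0, ∀ N : ℕ, ∃ ψ ψ' : E → E, IsAutPair ψ ψ' ∧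
    (∀ z ∈ closedBall (0 : E) R', ‖ψ z - z‖ ≤ ε) ∧
    (∀ z ∈ closedBall (0 : E) R', ‖ψ' z - z‖ ≤ ε) ∧
    (∀ j ≠ k, JetEq (N + 1) (p j) ψ fun z => z) ∧
    JetEq (N + 1) (p k) ψ fun z => p k + h (z - p k)

variable {p : ℕ → E} {k : ℕ} {R : ℝ}

lemma IsRealizable.id : IsRealizable p k R fun z => z :=
  ⟨differentiable_id, rfl, fun _ _ ε hε N => ⟨fun z => z, fun z => z, IsAutPair.refl,
    by simp [hε.le], by simp [hε.le], fun j _ => JetEq.refl _ _ _, by simpa using JetEq.refl _ _ _⟩⟩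

lemma norm_comp_sub_le {f g : E → E} {R₁ R₂ ε : ℝ}
    (hf : ∀ z ∈ closedBall (0 : E) R₂, ‖f z - z‖ ≤ min (ε / 2) (R₂ - R₁))
    (hg : ∀ z ∈ closedBall (0 : E) R₂, ‖g z - z‖ ≤ min (ε / 2) (R₂ - R₁)) (hR : R₁ ≤ R₂) :
    ∀ z ∈ closedBall (0 : E) R₁, ‖g (f z) - z‖ ≤ ε := by
  intro z hz
  have h1 := hf z (closedBall_subset_closedBall hR hz)
  rw [mem_closedBall_zero_iff] at hz
  have h2 := h1.trans (min_le_left _ _)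
  have h3 := h1.trans (min_le_right _ _)
  have h4 := norm_add_le (f z - z) z
  rw [sub_add_cancel] at h4
  have h5 := (hg (f z) (by rw [mem_closedBall_zero_iff]; linarith)).trans (min_le_left _ _)
  have h6 := norm_add_le (g (f z) - f z) (f z - z)
  rw [sub_add_sub_cancel] at h6
  linarith

lemma IsRealizable.comp {h₁ h₂ : E → E} (H₂ : IsRealizable p k R h₂) (H₁ : IsRealizable p k R h₁) :
    IsRealizable p k R fun z => h₂ (h₁ z) := by
  refine ⟨H₂.differentiable.comp H₁.differentiable, by rw [H₁.map_zero, H₂.map_zero],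
    fun R' hR' ε hε N => ?_⟩
  obtain ⟨R'', h1, h2⟩ := exists_between hR'
  have hδ : 0 < min (ε / 2) (R'' - R') := lt_min (by positivity) (sub_pos.2 h1)
  obtain ⟨ψ₁, ψ₁', a1, b1, c1, d1, e1⟩ := H₁.exists_aut R'' h2 _ hδ N
  obtain ⟨ψ₂, ψ₂', a2, b2, c2, d2, e2⟩ := H₂.exists_aut R'' h2 _ hδ N
  refine ⟨_, _, a2.comp a1, norm_comp_sub_le b1 b2 h1.le, norm_comp_sub_le c2 c1 h1.le,
    fun j hj => ?_, ?_⟩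
  · exact (d2 j hj).comp (d1 j hj) (d1 j hj).eq a1.left differentiable_id differentiable_id
  · have h3 : Differentiable ℂ fun z => p k + h₁ (z - p k) :=
      (H₁.differentiable.comp (differentiable_id.sub_const _)).const_add _
    have h4 : Differentiable ℂ fun z => p k + h₂ (z - p k) :=
      (H₂.differentiable.comp (differentiable_id.sub_const _)).const_add _
    have := e2.comp e1 (by simpa [H₁.map_zero] using e1.eq) a1.left h3 h4
    simpa using this

/-- The functions `(exp (c w) - 1) / c`, through which the flow of a linear vector field on a line
is expressed. -/
lemma exists_flow_function (c : ℂ) : ∃ Θ : ℂ → ℂ, Differentiable ℂ Θ ∧ Θ 0 = 0 ∧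
    (∀ w, Θ w + Θ (-w) + c * Θ w * Θ (-w) = 0) ∧ HasDerivAt Θ 1 0 ∧
    (1 + c ≠ 0 → ∃ w, Θ w = 1) := by
  rcases eq_or_ne c 0 with rfl | hc
  · exact ⟨fun w => w, differentiable_id, rfl, by simp, hasDerivAt_id 0, fun _ => ⟨1, rfl⟩⟩
  · refine ⟨fun w => (Complex.exp (c * w) - 1) / c, by fun_prop, by simp, fun w => ?_, ?_,
      fun h => ⟨Complex.log (1 + c) / c, ?_⟩⟩
    · have h1 : Complex.exp (c * w) * Complex.exp (c * -w) = 1 := by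
        rw [← Complex.exp_add]
        simp
      rw [mul_neg] at h1
      field_simp
      linear_combination h1
    · have := (((hasDerivAt_id (0 : ℂ)).const_mul c).cexp.sub_const 1).div_const c
      simpa [hc] using this
    · simp only [mul_div_cancel₀ _ hc, Complex.exp_log h]
      field_simp
      ring

/-- Shears and overshears in the direction of a vector `v` are realizable. -/
lemma isRealizable_shear [ProperSpace E] {l μ : E →L[ℂ] ℂ} {v : E} {r : ℝ} (hr : 0 ≤ r)
    (hrk : r < k + 1) (hlr : ∀ z ∈ closedBall (0 : E) R, ‖l z‖ ≤ r) (hlv : l v = 0)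
    (hlp : ∀ j, l (p j) = j + 1) {q : E → ℂ} (hq : Differentiable ℂ q)
    (hqv : ∀ z (s : ℂ), q (z + s • v) = q z) {Θ : ℂ → ℂ} (hΘ : Differentiable ℂ Θ)
    (hΘ0 : Θ 0 = 0) (hΘinv : ∀ w, Θ w + Θ (-w) + μ v * Θ w * Θ (-w) = 0) :
    IsRealizable p k R fun w => w + (Θ (q w) * μ w) • v := by
  refine ⟨by fun_prop, by simp, fun R' hR' ε hε N => ?_⟩
  obtain ⟨Q, hQ, hQb⟩ := exists_norm_le_on_closedBall
    (f := fun z => q (z - p k)) (hq.continuous.comp (by fun_prop)) R'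
  obtain ⟨C, hC, hCb⟩ := exists_norm_le_on_closedBall
    (f := fun z => μ (z - p k) • v) (by fun_prop) R'
  obtain ⟨η, hη, hball⟩ := Metric.eventually_nhds_iff_ball.1
    (hΘ.continuous.norm.tendsto 0 |>.eventually
      (gt_mem_nhds (by simpa [hΘ0] using div_pos hε hC)))
  obtain ⟨f, hf, hfr, hfj, hfk⟩ := exists_entire_jet_indicator (κ := k + 1) hr
    (by exact_mod_cast hrk) N (δ := η / (2 * Q)) (by positivity)
  set g : E → ℂ := fun z => f (l z) * q (z - p k) with hg
  have hgd : Differentiable ℂ g := by fun_prop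
  have hgv : ∀ z (s : ℂ), g (z + s • v) = g z := by
    intro z s
    simp only [hg, map_add, map_smul, hlv, smul_zero, add_zero]
    rw [add_sub_right_comm, hqv]
  have hgη : ∀ z ∈ closedBall (0 : E) R', ‖g z‖ < η := by
    intro z hz
    have h1 := hfr (l z) (by
      rw [mem_closedBall_zero_iff]
      exact hlr z (closedBall_subset_closedBall hR'.le hz))
    have h2 := hQb z hz
    calc ‖g z‖ = ‖f (l z)‖ * ‖q (z - p k)‖ := norm_mul _ _
      _ ≤ η / (2 * Q) * Q := by gcongr
      _ < η := by
        field_simp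
        linarith
  have hsmall : ∀ z ∈ closedBall (0 : E) R', ∀ w : ℂ, ‖w‖ < η →
      ‖z + (Θ w * μ (z - p k)) • v - z‖ ≤ ε := by
    intro z hz w hw
    have h1 := hball w (by rwa [mem_ball_zero_iff])
    have h2 := hCb z hz
    rw [add_sub_cancel_left, mul_smul, norm_smul]
    calc ‖Θ w‖ * ‖μ (z - p k) • v‖ ≤ ε / C * C := by gcongr
      _ = ε := by field_simp
  have hinv : ∀ (g : E → ℂ), (∀ z (s : ℂ), g (z + s • v) = g z) → ∀ z,
      (z + (Θ (g z) * μ (z - p k)) • v) +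
        (Θ (-g (z + (Θ (g z) * μ (z - p k)) • v)) *
          μ (z + (Θ (g z) * μ (z - p k)) • v - p k)) • v = z := by
    intro g hgv z
    rw [hgv, add_sub_right_comm, map_add, map_smul, add_assoc, ← add_smul]
    convert add_zero z
    rw [smul_eq_mul]
    convert zero_smul ℂ v
    linear_combination μ (z - p k) * hΘinv (g z)
  refine ⟨fun z => z + (Θ (g z) * μ (z - p k)) • v, fun z => z + (Θ (-g z) * μ (z - p k)) • v,
    ⟨by fun_prop, by fun_prop, hinv g hgv, fun z => ?_⟩, fun z hz => hsmall z hz _ (hgη z hz),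
    fun z hz => hsmall z hz _ (by rw [norm_neg]; exact hgη z hz), fun j hj => ?_, ?_⟩
  · simpa using hinv (fun z => -g z) (by simp [hgv]) z
  · have hlj : (fun z => ‖l z - ((j + 1 : ℕ) : ℂ)‖) =O[𝓝 (p j)] fun z => ‖z - p j‖ := by
      simpa [hlp] using (sub_isBigO_norm_sub l.differentiable (p j)).norm_left
    have h1 : g =O[𝓝 (p j)] fun z => ‖z - p j‖ ^ (N + 1) := by
      have h2 := ((hfj (j + 1) (by omega)).comp_tendsto
        (l.continuous.tendsto' (p j) _ (by simp [hlp]))).trans (hlj.pow (N + 1))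
      have h3 : (fun z => q (z - p k)) =O[𝓝 (p j)] fun _ => (1 : ℝ) :=
        (Continuous.tendsto (hq.continuous.comp (by fun_prop)) _).isBigO_one ℝ
      simpa using h2.mul h3
    have hgj : g (p j) = 0 := eq_zero_of_isBigO_pow N.succ_ne_zero h1
    have h4 : (fun z => Θ (g z) - Θ 0) =O[𝓝 (p j)] fun z => g z - 0 :=
      sub_isBigO_sub hΘ (hgd.continuous.tendsto' _ _ hgj) tendsto_const_nhds
    simp only [hΘ0, sub_zero] at h4
    have h5 : (fun z => μ (z - p k) • v) =O[𝓝 (p j)] fun _ => (1 : ℝ) :=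
      (Continuous.tendsto (by fun_prop) _).isBigO_one ℝ
    simpa [JetEq, mul_smul] using (h4.trans h1).smul h5
  · have hlk : (fun z => ‖l z - ((k + 1 : ℕ) : ℂ)‖) =O[𝓝 (p k)] fun z => ‖z - p k‖ := by
      simpa [hlp] using (sub_isBigO_norm_sub l.differentiable (p k)).norm_left
    have hfk1 : f ((k + 1 : ℕ) : ℂ) = 1 :=
      sub_eq_zero.1 (eq_zero_of_isBigO_pow (f := fun ζ => f ζ - 1) N.succ_ne_zero hfk)
    have h1 : (fun z => g z - q (z - p k)) =O[𝓝 (p k)] fun z => ‖z - p k‖ ^ (N + 1) := by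
      have h2 := (hfk.comp_tendsto
        (l.continuous.tendsto' (p k) _ (by simp [hlp]))).trans (hlk.pow (N + 1))
      have h3 : (fun z => q (z - p k)) =O[𝓝 (p k)] fun _ => (1 : ℝ) :=
        (Continuous.tendsto (hq.continuous.comp (by fun_prop)) _).isBigO_one ℝ
      simpa [hg, sub_mul] using h2.mul h3
    have h4 : (fun z => Θ (g z) - Θ (q (z - p k))) =O[𝓝 (p k)]
        fun z => g z - q (z - p k) := by
      refine sub_isBigO_sub hΘ (c := q 0) (hgd.continuous.tendsto' _ _ ?_)
        ((hq.continuous.comp (by fun_prop)).tendsto' _ _ (by simp))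
      push_cast at hfk1
      simp [hg, hlp, hfk1]
    have h5 : (fun z => μ (z - p k) • v) =O[𝓝 (p k)] fun _ => (1 : ℝ) :=
      (Continuous.tendsto (by fun_prop) _).isBigO_one ℝ
    have h6 := (h4.trans h1).smul h5
    simp only [smul_eq_mul, mul_one] at h6
    refine h6.congr_left fun z => ?_
    simp only [mul_smul, sub_smul]
    abel

end Realizable

/-! ### Linear jets -/

section Linear

variable {n : ℕ} [NeZero n]

/-- The points `(j + 1, 0, …, 0)`. -/
def stdPoint (n : ℕ) [NeZero n] (j : ℕ) : EuclideanSpace ℂ (Fin n) :=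
  EuclideanSpace.single 0 ((j : ℂ) + 1)

/-- Realizability at the `k`-th point of the standard sequence, up to radius `k + 1 / 2`. -/
abbrev IsStdRealizable (k : ℕ) (h : EuclideanSpace ℂ (Fin n) → EuclideanSpace ℂ (Fin n)) : Prop :=
  IsRealizable (stdPoint n) k (k + 1 / 2) h

variable {k : ℕ}

lemma isStdRealizable_shear_coord {i : Fin n} (hi : i ≠ 0)
    {μ : EuclideanSpace ℂ (Fin n) →L[ℂ] ℂ} {q : EuclideanSpace ℂ (Fin n) → ℂ}
    (hq : Differentiable ℂ q) (hqv : ∀ z (s : ℂ), q (z + s • EuclideanSpace.single i 1) = q z)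
    {Θ : ℂ → ℂ} (hΘ : Differentiable ℂ Θ) (hΘ0 : Θ 0 = 0)
    (hΘinv : ∀ w, Θ w + Θ (-w) + μ (EuclideanSpace.single i 1) * Θ w * Θ (-w) = 0) :
    IsStdRealizable k fun w => w + (Θ (q w) * μ w) • EuclideanSpace.single i 1 := by
  refine isRealizable_shear (l := EuclideanSpace.proj 0) (r := k + 1 / 2) (by positivity)
    (by linarith) (fun z hz => ?_) (by simp [hi.symm]) (by simp [stdPoint]) hq hqv hΘ hΘ0 hΘinv
  rw [mem_closedBall_zero_iff] at hz
  exact (PiLp.norm_apply_le z 0).trans hz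

lemma isStdRealizable_add_smul_single_of_ne {i : Fin n} (hi : i ≠ 0)
    {φ : EuclideanSpace ℂ (Fin n) →L[ℂ] ℂ} (hφ : 1 + φ (EuclideanSpace.single i 1) ≠ 0) :
    IsStdRealizable k fun w => w + φ w • EuclideanSpace.single i 1 := by
  obtain ⟨Θ, h1, h2, h3, -, h5⟩ := exists_flow_function (φ (EuclideanSpace.single i 1))
  obtain ⟨w₀, hw₀⟩ := h5 hφ
  simpa [hw₀] using isStdRealizable_shear_coord (k := k) hi (μ := φ) (q := fun _ => w₀)
    (differentiable_const _) (by simp) h1 h2 h3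

lemma isStdRealizable_add_smul_single [Nontrivial (Fin n)] (i : Fin n)
    {φ : EuclideanSpace ℂ (Fin n) →L[ℂ] ℂ} (hφ : 1 + φ (EuclideanSpace.single i 1) ≠ 0) :
    IsStdRealizable k fun w => w + φ w • EuclideanSpace.single i 1 := by
  rcases ne_or_eq i 0 with hi | rfl
  · exact isStdRealizable_add_smul_single_of_ne hi hφ
  obtain ⟨i, hi⟩ := exists_ne (0 : Fin n)
  set t : ℝ := 1 / (4 * (k + 1)) with ht
  have htpos : 0 < t := by positivity
  have htC : (t : ℂ) ≠ 0 := by exact_mod_cast htpos.ne'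
  set v : EuclideanSpace ℂ (Fin n) := (t : ℂ) • EuclideanSpace.single 0 1 + EuclideanSpace.single i 1
    with hv
  have hconj : ∀ s : ℂ, IsStdRealizable k fun w : EuclideanSpace ℂ (Fin n) =>
      w + (s • EuclideanSpace.proj 0 : EuclideanSpace ℂ (Fin n) →L[ℂ] ℂ) w •
        EuclideanSpace.single i 1 := fun s =>
    isStdRealizable_add_smul_single_of_ne hi (by simp [hi.symm])
  set g : EuclideanSpace ℂ (Fin n) →L[ℂ] EuclideanSpace ℂ (Fin n) :=
    ContinuousLinearMap.id ℂ _ + ((-(t : ℂ)⁻¹) • EuclideanSpace.proj 0 :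
      EuclideanSpace ℂ (Fin n) →L[ℂ] ℂ).smulRight (EuclideanSpace.single i 1) with hg
  have hgv : g v = (t : ℂ) • EuclideanSpace.single 0 1 := by
    simp [hg, hv, hi.symm, htC]
  obtain ⟨Θ, h1, h2, h3, -, h5⟩ := exists_flow_function (φ (EuclideanSpace.single 0 1))
  obtain ⟨w₀, hw₀⟩ := h5 hφ
  have hμ : ((t : ℂ)⁻¹ • φ.comp g) v = φ (EuclideanSpace.single 0 1) := by
    simp [hgv, htC]
  have hmid : IsStdRealizable k fun w : EuclideanSpace ℂ (Fin n) =>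
      w + (Θ w₀ * ((t : ℂ)⁻¹ • φ.comp g) w) • v := by
    refine isRealizable_shear (l := EuclideanSpace.proj 0 - (t : ℂ) • EuclideanSpace.proj i)
      (q := fun _ => w₀) (r := k + 3 / 4) (by positivity) (by linarith) (fun z hz => ?_) ?_
      (by simp [stdPoint, hi]) (differentiable_const _) (by simp) h1 h2 (by rwa [hμ])
    · rw [mem_closedBall_zero_iff] at hz
      have e1 := PiLp.norm_apply_le z 0
      have e2 := PiLp.norm_apply_le z i
      have e3 : t * (k + 1 / 2) ≤ 1 / 4 := by
        rw [ht, div_mul_eq_mul_div, div_le_div_iff₀ (by positivity) (by positivity)]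
        linarith
      calc ‖(EuclideanSpace.proj 0 - (t : ℂ) • EuclideanSpace.proj i :
            EuclideanSpace ℂ (Fin n) →L[ℂ] ℂ) z‖ ≤ ‖z 0‖ + ‖(t : ℂ) * z i‖ := norm_sub_le _ _
        _ = ‖z 0‖ + t * ‖z i‖ := by
          rw [norm_mul, Complex.norm_real, Real.norm_of_nonneg htpos.le]
        _ ≤ (k + 1 / 2) + t * (k + 1 / 2) := by gcongr <;> linarith
        _ ≤ _ := by linarith
    · simp [hv, hi, hi.symm]
  have hfin := ((hconj (-(t : ℂ)⁻¹)).comp hmid).comp (hconj (t : ℂ)⁻¹)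
  convert hfin using 2 with w
  have hcomp : ∀ w : EuclideanSpace ℂ (Fin n), w + ((-(t : ℂ)⁻¹) • EuclideanSpace.proj 0 :
      EuclideanSpace ℂ (Fin n) →L[ℂ] ℂ) w • EuclideanSpace.single i 1 = g w := fun w => rfl
  have hginv : g (w + ((t : ℂ)⁻¹ • EuclideanSpace.proj 0 :
      EuclideanSpace ℂ (Fin n) →L[ℂ] ℂ) w • EuclideanSpace.single i 1) = w := by
    simp [hg, hi.symm]
  rw [hcomp, map_add, map_smul, hgv, hginv, hw₀, smul_apply,
    ContinuousLinearMap.comp_apply, hginv, smul_smul]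
  congr 2
  simp only [smul_eq_mul]
  field_simp

lemma isStdRealizable_mulVec [Nontrivial (Fin n)] {M : Matrix (Fin n) (Fin n) ℂ}
    (hM : M.det ≠ 0) : IsStdRealizable k fun z => WithLp.toLp 2 (M.mulVec z.ofLp) := by
  refine Matrix.diagonal_transvection_induction_of_det_ne_zero
    (fun M => IsStdRealizable k fun z => WithLp.toLp 2 (M.mulVec z.ofLp)) M hM
    (fun D hD => ?_) (fun t => ?_) fun A B _ _ hA hB => ?_
  · rw [Matrix.det_diagonal, Finset.prod_ne_zero_iff] at hD
    have hs : ∀ s : Finset (Fin n), IsStdRealizable k fun z : EuclideanSpace ℂ (Fin n) =>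
        WithLp.toLp 2 fun i => if i ∈ s then D i * z i else z i := by
      intro s
      induction s using Finset.induction_on with
      | empty => exact IsRealizable.id
      | insert a s ha ih =>
        convert ih.comp (isStdRealizable_add_smul_single (k := k) a
          (φ := (D a - 1) • EuclideanSpace.proj a) (by simpa using hD a (Finset.mem_univ a)))
          using 2 with z
        ext i
        rcases eq_or_ne i a with rfl | hia
        · simp [ha]
          ring
        · simp [hia]
    convert hs Finset.univ using 2 with z
    ext i
    simp [Matrix.mulVec_diagonal]
  · convert isStdRealizable_add_smul_single (k := k) t.i (φ := t.c • EuclideanSpace.proj t.j)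
      (by simp [t.hij]) using 2 with z
    ext l
    simp [Matrix.TransvectionStruct.toMatrix, Matrix.transvection, Matrix.add_mulVec,
      Matrix.single_mulVec_eq, Pi.single_apply, -Matrix.mulVec_single]
  · convert hA.comp hB using 2 with z
    simp [Matrix.mulVec_mulVec]

lemma isStdRealizable_clm [Nontrivial (Fin n)]
    (A : EuclideanSpace ℂ (Fin n) ≃L[ℂ] EuclideanSpace ℂ (Fin n)) :
    IsStdRealizable k fun z => A z := by
  set M : (EuclideanSpace ℂ (Fin n) →L[ℂ] EuclideanSpace ℂ (Fin n)) → Matrix (Fin n) (Fin n) ℂ :=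
    fun A => Matrix.of fun i j => A (EuclideanSpace.single j 1) i with hM
  have hMA : ∀ (A : EuclideanSpace ℂ (Fin n) →L[ℂ] EuclideanSpace ℂ (Fin n)) z i,
      (M A).mulVec z.ofLp i = A z i := by
    intro A z i
    rw [clm_apply_eq_sum A z]
    simp [hM, Matrix.mulVec, dotProduct, mul_comm]
  have hdet : (M A).det ≠ 0 := by
    refine Matrix.det_ne_zero_of_right_inverse (B := M A.symm) ?_
    ext i j
    have := hMA A (A.symm (EuclideanSpace.single j 1)) i
    simp only [ContinuousLinearEquiv.coe_coe, ContinuousLinearEquiv.apply_symm_apply] at this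
    calc (M A * M A.symm) i j
        = (M A).mulVec (A.symm (EuclideanSpace.single j 1)).ofLp i := rfl
      _ = (1 : Matrix (Fin n) (Fin n) ℂ) i j := by
        rw [this]
        simp [Matrix.one_apply]
  convert isStdRealizable_mulVec (k := k) hdet using 2 with z
  ext i
  exact (hMA A z i).symm

end Linear

/-! ### Higher order jets -/

section Coefficients

variable {V : Type*} [AddCommGroup V] [Module ℂ V]

lemma coeff_mem_of_forall_sum_mem (S : Submodule ℂ V) (c : ℕ → V) (M : ℕ)
    (h : ∀ t : ℂ, ∑ k ∈ Finset.range M, t ^ k • c k ∈ S) {k : ℕ} (hk : k < M) : c k ∈ S := by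
  by_contra hc
  obtain ⟨φ, hφ, hS⟩ := Submodule.exists_le_ker_of_notMem hc
  set P : Polynomial ℂ := ∑ k ∈ Finset.range M, Polynomial.monomial k (φ (c k)) with hP
  have hP0 : P = 0 := by
    refine Polynomial.funext fun t => ?_
    have := hS (h t)
    rw [LinearMap.mem_ker, map_sum] at this
    simpa [hP, Polynomial.eval_finsetSum, mul_comm] using this
  refine hφ ?_
  have : P.coeff k = φ (c k) := by
    simp [hP, Polynomial.coeff_monomial, hk]
  rw [← this, hP0, Polynomial.coeff_zero]

lemma sub_mem_of_forall_sum_sub_mem (S : Submodule ℂ V) (a b : ℕ → V) (M : ℕ)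
    (ha : a (M + 1) = 0)
    (h : ∀ t : ℂ, ∑ k ∈ Finset.range (M + 1), t ^ k • a k -
      t • ∑ k ∈ Finset.range (M + 1), t ^ k • b k ∈ S) : a 1 - b 0 ∈ S := by
  refine coeff_mem_of_forall_sum_mem S (fun k => a k - Nat.casesOn k 0 b) (M + 2) (fun t => ?_)
    (k := 1) (by omega)
  convert h t using 1
  simp only [smul_sub, Finset.sum_sub_distrib]
  congr 1
  · rw [Finset.sum_range_succ _ (M + 1), ha, smul_zero, add_zero]
  · rw [Finset.sum_range_succ' _ (M + 1), Finset.smul_sum]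
    simp [pow_succ', mul_smul]

end Coefficients

section HigherOrder

variable {n : ℕ} [NeZero n] {k : ℕ}

lemma norm_monomialFun_le (α : Fin n → ℕ) (z : EuclideanSpace ℂ (Fin n)) :
    ‖monomialFun α z‖ ≤ ‖z‖ ^ (∑ i, α i) := by
  rw [monomialFun, norm_prod, ← Finset.prod_pow_eq_pow_sum]
  gcongr with i
  rw [norm_pow]
  gcongr
  exact PiLp.norm_apply_le z i

lemma monomialFun_isBigO (α : Fin n → ℕ) :
    monomialFun α =O[𝓝 0] fun z => ‖z‖ ^ (∑ i, α i) :=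
  IsBigO.of_bound 1 (Eventually.of_forall fun z => by simpa using norm_monomialFun_le α z)

/-- Vector fields of order `d + 2` which are leading terms of realizable maps tangent to the
identity. -/
def leadingFields (n k d : ℕ) [NeZero n] :
    Submodule ℂ (EuclideanSpace ℂ (Fin n) → EuclideanSpace ℂ (Fin n)) where
  carrier := {K | Differentiable ℂ K ∧ K =O[𝓝 0] (fun z => ‖z‖ ^ (d + 2)) ∧
    ∀ c : ℂ, ∃ h, IsStdRealizable k h ∧
      (fun z => h z - z - c • K z) =O[𝓝 0] fun z => ‖z‖ ^ (d + 3)}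
  zero_mem' := ⟨differentiable_const _, isBigO_zero _ _, fun c =>
    ⟨_, IsRealizable.id, by simpa using isBigO_zero _ _⟩⟩
  smul_mem' := by
    rintro a K ⟨hK, hKO, hKr⟩
    refine ⟨hK.const_smul a, hKO.const_smul_left a, fun c => ?_⟩
    obtain ⟨h, h1, h2⟩ := hKr (c * a)
    exact ⟨h, h1, by simpa [mul_smul] using h2⟩
  add_mem' := by
    rintro K₁ K₂ ⟨hK₁, hKO₁, hKr₁⟩ ⟨hK₂, hKO₂, hKr₂⟩
    refine ⟨hK₁.add hK₂, hKO₁.add hKO₂, fun c => ?_⟩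
    obtain ⟨h₁, r₁, o₁⟩ := hKr₁ c
    obtain ⟨h₂, r₂, o₂⟩ := hKr₂ c
    refine ⟨_, r₂.comp r₁, ?_⟩
    have hh₁ : h₁ =O[𝓝 0] fun z => ‖z‖ := by
      simpa [r₁.map_zero] using sub_isBigO_norm_sub r₁.differentiable 0
    have e1 : (fun z => h₂ (h₁ z) - h₁ z - c • K₂ (h₁ z)) =O[𝓝 0] fun z => ‖z‖ ^ (d + 3) :=
      (o₂.comp_tendsto (r₁.differentiable.continuous.tendsto' 0 0 r₁.map_zero)).trans
        (hh₁.norm_left.pow (d + 3))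
    have e2 : (fun z => h₁ z - z) =O[𝓝 0] fun z => ‖z‖ ^ 2 := by
      have := (o₁.trans (isBigO_pow_of_le_zero (by omega : 2 ≤ d + 3))).add
        ((hKO₁.const_smul_left c).trans (isBigO_pow_of_le_zero (by omega : 2 ≤ d + 2)))
      simpa using this
    have e3 : (fun z => K₂ (h₁ z) - K₂ z) =O[𝓝 0] fun z => ‖z‖ ^ (d + 3) :=
      comp_sub_comp_isBigO hK₂ hKO₂ hh₁ (isBigO_refl _ _).norm_right e2
    refine ((e1.add o₁).add (e3.const_smul_left c)).congr_left fun z => ?_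
    simp only [Pi.add_apply, Pi.smul_apply, smul_add, smul_sub]
    abel

lemma conj_mem_leadingFields {d : ℕ} {A B : EuclideanSpace ℂ (Fin n) →L[ℂ] EuclideanSpace ℂ (Fin n)}
    (hA : IsStdRealizable k fun z => A z) (hB : IsStdRealizable k fun z => B z)
    (hBA : ∀ z, B (A z) = z) {K : EuclideanSpace ℂ (Fin n) → EuclideanSpace ℂ (Fin n)}
    (hK : K ∈ leadingFields n k d) : (fun z => B (K (A z))) ∈ leadingFields n k d := by
  obtain ⟨hKd, hKO, hKr⟩ := hK
  have hAO : (fun z => A z) =O[𝓝 0] fun z => ‖z‖ := (A.isBigO_id _).norm_right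
  have key : ∀ {f : EuclideanSpace ℂ (Fin n) → EuclideanSpace ℂ (Fin n)} {m : ℕ},
      f =O[𝓝 0] (fun z => ‖z‖ ^ m) → (fun z => B (f (A z))) =O[𝓝 0] fun z => ‖z‖ ^ m :=
    fun hf => (B.isBigO_comp _ _).trans <|
      (hf.comp_tendsto (A.continuous.tendsto' 0 0 (map_zero A))).trans (hAO.norm_left.pow _)
  refine ⟨by fun_prop, key hKO, fun c => ?_⟩
  obtain ⟨h, hr, ho⟩ := hKr c
  exact ⟨_, (hB.comp hr).comp hA, by simpa [hBA] using key ho⟩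

lemma coord_mul_monomialFun_smul_mem {d : ℕ} {i : Fin n} (hi : i ≠ 0) {α : Fin n → ℕ}
    (hα : α i = 0) (hd : ∑ l, α l = d + 1) (j : Fin n) :
    (fun z => (z j * monomialFun α z) • EuclideanSpace.single i (1 : ℂ)) ∈
      leadingFields n k d := by
  have hq := differentiable_monomialFun α
  have hqO := monomialFun_isBigO α
  rw [hd] at hqO
  have hj := differentiable_coord j
  have hjO : (fun z : EuclideanSpace ℂ (Fin n) => z j) =O[𝓝 0] fun z => ‖z‖ :=
    IsBigO.of_bound 1 (Eventually.of_forall fun z => by simpa using PiLp.norm_apply_le z j)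
  have hiO : (fun _ : EuclideanSpace ℂ (Fin n) => EuclideanSpace.single i (1 : ℂ)) =O[𝓝 0]
      fun _ : EuclideanSpace ℂ (Fin n) => (1 : ℝ) := isBigO_const_const _ one_ne_zero _
  have hinv : ∀ z (s : ℂ), monomialFun α (z + s • EuclideanSpace.single i 1) =
      monomialFun α z := by
    intro z s
    refine Finset.prod_congr rfl fun l _ => ?_
    rcases eq_or_ne l i with rfl | hl
    · simp [hα]
    · simp [hl]
  refine ⟨by fun_prop, ?_, fun c => ?_⟩
  · refine ((hjO.mul hqO).smul hiO).congr_right fun z => ?_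
    rw [smul_eq_mul]
    ring
  · obtain ⟨Θ, h1, h2, h3, h4, -⟩ := exists_flow_function
      (EuclideanSpace.proj (𝕜 := ℂ) j (EuclideanSpace.single i 1))
    refine ⟨_, isStdRealizable_shear_coord hi (hq.const_smul c) (by simp [hinv]) h1 h2 h3, ?_⟩
    have h0 : monomialFun α 0 = 0 :=
      eq_zero_of_isBigO_pow (N := d + 1) d.succ_ne_zero (by simpa using hqO)
    have e1 : (fun x : ℂ => Θ x - x) =O[𝓝 0] fun x => ‖x‖ ^ 2 := by
      simpa [h2, h4.hasFDerivAt.fderiv] using sub_fderiv_isBigO h1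
    have e2 : (fun z => Θ (c • monomialFun α z) - c • monomialFun α z) =O[𝓝 0]
        fun z => (‖z‖ ^ (d + 1)) ^ 2 :=
      (e1.comp_tendsto ((hq.const_smul c).continuous.tendsto' 0 0 (by simp [h0]))).trans
        ((hqO.const_smul_left c).norm_left.pow 2)
    have e3 : (fun z : EuclideanSpace ℂ (Fin n) => (‖z‖ ^ (d + 1)) ^ 2 * ‖z‖) =O[𝓝 0]
        fun z => ‖z‖ ^ (d + 3) := by
      simp only [← pow_mul, ← pow_succ]
      exact isBigO_pow_of_le_zero (by omega)
    refine (((e2.mul hjO).trans e3).smul hiO).congr (fun z => ?_) fun z => by simp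
    simp only [Pi.smul_apply, smul_eq_mul, PiLp.proj_apply]
    rw [add_sub_cancel_left, smul_smul, ← sub_smul]
    congr 1
    ring

lemma monomialFun_smul_mem_of_eq_zero {d : ℕ} {i : Fin n} (hi : i ≠ 0) {α : Fin n → ℕ}
    (hα : α i = 0) (hd : ∑ l, α l = d + 2) :
    (fun z => monomialFun α z • EuclideanSpace.single i (1 : ℂ)) ∈ leadingFields n k d := by
  obtain ⟨j, -, hj⟩ := Finset.exists_ne_zero_of_sum_ne_zero (by omega : ∑ l, α l ≠ 0)
  have hα' : α = (α - Pi.single j 1) + Pi.single j 1 := by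
    refine (tsub_add_cancel_of_le fun l => ?_).symm
    rcases eq_or_ne l j with rfl | hl
    · simpa using Nat.one_le_iff_ne_zero.2 hj
    · simp [hl]
  rw [hα', ← coord_mul_monomialFun]
  refine coord_mul_monomialFun_smul_mem hi (by simp [hα]) ?_ j
  rw [hα'] at hd
  simpa [Finset.sum_add_distrib] using hd

/-- The vector field `z ↦ z_i ^ j z_0 ^ D z ^ γ e_m`. -/
def monomialField (γ : Fin n → ℕ) (i m : Fin n) (j D : ℕ) (z : EuclideanSpace ℂ (Fin n)) :
    EuclideanSpace ℂ (Fin n) :=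
  (z i ^ j * z 0 ^ D * monomialFun γ z) • EuclideanSpace.single m 1

/-- Conjugation with the transvections in the direction of the first coordinate. -/
lemma sum_monomialField_mem [Nontrivial (Fin n)] {d : ℕ} {i m : Fin n} (hi : i ≠ 0)
    {γ : Fin n → ℕ} (hγ : γ 0 = 0) {j D : ℕ} (h : monomialField γ i m j D ∈ leadingFields n k d)
    (t : ℂ) :
    ∑ l ∈ Finset.range (D + 1), t ^ l • (D.choose l : ℂ) • monomialField γ i m (j + l) (D - l) -
      t • ∑ l ∈ Finset.range (D + 1), t ^ l • (if m = i then (D.choose l : ℂ) else 0) •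
        monomialField γ i 0 (j + l) (D - l) ∈ leadingFields n k d := by
  set A : ℂ → EuclideanSpace ℂ (Fin n) →L[ℂ] EuclideanSpace ℂ (Fin n) := fun t =>
    ContinuousLinearMap.id ℂ _ + (t • EuclideanSpace.proj i :
      EuclideanSpace ℂ (Fin n) →L[ℂ] ℂ).smulRight (EuclideanSpace.single 0 1) with hA
  have hAz : ∀ t z, A t z = z + (t * z i) • EuclideanSpace.single 0 1 := fun t z => rfl
  have hAr : ∀ t, IsStdRealizable k fun z => A t z := fun t =>
    isStdRealizable_add_smul_single 0 (φ := t • EuclideanSpace.proj i) (by simp [hi])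
  have hinv : ∀ z, A (-t) (A t z) = z := by
    intro z
    simp only [hAz, PiLp.add_apply, PiLp.smul_apply, PiLp.single_apply, hi]
    simp
  convert conj_mem_leadingFields (hAr t) (hAr (-t)) hinv h using 1
  funext z
  have e1 : monomialFun γ (A t z) = monomialFun γ z := by
    refine Finset.prod_congr rfl fun l _ => ?_
    rcases eq_or_ne l 0 with rfl | hl
    · simp [hγ]
    · simp [hAz, hl]
  have e2 : (A t z) i = z i := by simp [hAz, hi]
  have e3 : (A t z) 0 = t * z i + z 0 := by simp [hAz, add_comm]
  have e4 : A (-t) (EuclideanSpace.single m 1) =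
      EuclideanSpace.single m 1 - (if m = i then t else 0) • EuclideanSpace.single 0 1 := by
    rw [hAz]
    by_cases hm : m = i <;> simp [hm, sub_eq_add_neg]
  have e5 : A (-t) (monomialField γ i m j D (A t z)) =
      (z i ^ j * (t * z i + z 0) ^ D * monomialFun γ z) • (EuclideanSpace.single m 1 -
        (if m = i then t else 0) • EuclideanSpace.single 0 1) := by
    rw [monomialField, map_smul, e1, e2, e3, e4]
  rw [e5, smul_sub, add_pow, Pi.sub_apply]
  simp only [monomialField, Finset.mul_sum, Finset.sum_mul, Finset.sum_smul, Finset.sum_apply,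
    Pi.smul_apply, Finset.smul_sum, smul_smul]
  refine congr_arg₂ _ (Finset.sum_congr rfl fun l _ => ?_) (Finset.sum_congr rfl fun l _ => ?_)
  · congr 1
    ring
  · congr 1
    split_ifs <;> ring

lemma monomialField_eq (γ : Fin n → ℕ) (i m : Fin n) (j D : ℕ) :
    monomialField γ i m j D = fun z =>
      monomialFun (γ + Pi.single i j + Pi.single 0 D) z • EuclideanSpace.single m (1 : ℂ) := by
  have hs : ∀ (z : EuclideanSpace ℂ (Fin n)) (i : Fin n) (j : ℕ),
      ∏ l, z l ^ (Pi.single i j : Fin n → ℕ) l = z i ^ j := by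
    intro z i j
    rw [Finset.prod_eq_single i (fun l _ hl => by simp [hl]) (by simp), Pi.single_eq_same]
  funext z
  simp only [monomialField, monomialFun, Pi.add_apply, pow_add, Finset.prod_mul_distrib, hs]
  congr 1
  ring

variable [Nontrivial (Fin n)]

lemma monomialField_mem {d : ℕ} {i : Fin n} (hi : i ≠ 0) {γ : Fin n → ℕ} (hγ0 : γ 0 = 0)
    (hγi : γ i = 0) (j D : ℕ) (hd : ∑ l, γ l + j + D = d + 2) :
    monomialField γ i 0 j D ∈ leadingFields n k d ∧
      monomialField γ i i j D ∈ leadingFields n k d := by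
  have hX0 : ∀ D, ∑ l, γ l + D = d + 2 → monomialField γ i i 0 D ∈ leadingFields n k d := by
    intro D hD
    rw [monomialField_eq]
    exact monomialFun_smul_mem_of_eq_zero hi (by simp [hγi, hi])
      (by simpa [Finset.sum_add_distrib] using hD)
  have hX1 : ∀ D, ∑ l, γ l + 1 + D = d + 2 → monomialField γ i i 1 D ∈ leadingFields n k d := by
    intro D hD
    rw [monomialField_eq, add_right_comm, ← coord_mul_monomialFun]
    exact coord_mul_monomialFun_smul_mem hi (by simp [hγi, hi])
      (by simp only [Pi.add_apply, Finset.sum_add_distrib, Finset.sum_pi_single', Finset.mem_univ,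
        if_true]; omega) i
  have hXY : ∀ j D, monomialField γ i i j D ∈ leadingFields n k d →
      (D : ℂ) • monomialField γ i i (j + 1) (D - 1) - monomialField γ i 0 j D ∈
        leadingFields n k d := by
    intro j D h
    simpa using sub_mem_of_forall_sum_sub_mem _
      (fun l => (D.choose l : ℂ) • monomialField γ i i (j + l) (D - l))
      (fun l => (if i = i then (D.choose l : ℂ) else 0) • monomialField γ i 0 (j + l) (D - l)) D
      (by simp) (sum_monomialField_mem hi hγ0 h)
  have hYY : ∀ j D, monomialField γ i 0 j D ∈ leadingFields n k d →
      (D : ℂ) • monomialField γ i 0 (j + 1) (D - 1) ∈ leadingFields n k d := by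
    intro j D h
    simpa [hi.symm] using sub_mem_of_forall_sum_sub_mem _
      (fun l => (D.choose l : ℂ) • monomialField γ i 0 (j + l) (D - l))
      (fun l => (if 0 = i then (D.choose l : ℂ) else 0) • monomialField γ i 0 (j + l) (D - l)) D
      (by simp) (sum_monomialField_mem hi hγ0 h)
  have hY : ∀ j D, ∑ l, γ l + j + D = d + 2 → monomialField γ i 0 j D ∈ leadingFields n k d := by
    intro j
    induction j with
    | zero =>
      intro D hD
      have h1 := hXY 0 D (hX0 D hD)
      have h2 : (D : ℂ) • monomialField γ i i (0 + 1) (D - 1) ∈ leadingFields n k d := by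
        rcases Nat.eq_zero_or_pos D with rfl | hD0
        · simp
        · exact Submodule.smul_mem _ _ (hX1 _ (by omega))
      simpa using Submodule.sub_mem _ h2 h1
    | succ j ih =>
      intro D hD
      have h1 := hYY j (D + 1) (ih (D + 1) (by omega))
      rwa [Submodule.smul_mem_iff _ (by exact_mod_cast D.succ_ne_zero), Nat.add_sub_cancel] at h1
  refine ⟨hY j D hd, ?_⟩
  induction j generalizing D with
  | zero => exact hX0 D (by omega)
  | succ j ih =>
    have h1 := Submodule.add_mem _ (hXY j (D + 1) (ih (D + 1) (by omega)))
      (hY j (D + 1) (by omega))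
    rwa [sub_add_cancel, Submodule.smul_mem_iff _ (by exact_mod_cast D.succ_ne_zero),
      Nat.add_sub_cancel] at h1

lemma monomialFun_smul_mem {d : ℕ} {α : Fin n → ℕ} (hd : ∑ l, α l = d + 2) (m : Fin n) :
    (fun z => monomialFun α z • EuclideanSpace.single m (1 : ℂ)) ∈ leadingFields n k d := by
  have key : ∀ i : Fin n, i ≠ 0 → ∃ (γ : Fin n → ℕ), γ 0 = 0 ∧ γ i = 0 ∧
      α = γ + Pi.single i (α i) + Pi.single 0 (α 0) := by
    intro i hi
    refine ⟨fun l => if l = 0 ∨ l = i then 0 else α l, by simp, by simp, ?_⟩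
    funext l
    by_cases h0 : l = 0
    · subst h0
      simp [hi.symm]
    · by_cases h1 : l = i
      · subst h1
        simp [h0]
      · simp [h0, h1]
  rcases eq_or_ne m 0 with rfl | hm
  · obtain ⟨i, hi⟩ := exists_ne (0 : Fin n)
    obtain ⟨γ, h0, h1, h2⟩ := key i hi
    rw [h2, Finset.sum_congr rfl fun l _ => Pi.add_apply _ _ l] at hd
    rw [h2, ← monomialField_eq]
    exact (monomialField_mem hi h0 h1 _ _ (by simpa [Finset.sum_add_distrib] using hd)).1
  · obtain ⟨γ, h0, h1, h2⟩ := key m hm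
    rw [h2, Finset.sum_congr rfl fun l _ => Pi.add_apply _ _ l] at hd
    rw [h2, ← monomialField_eq]
    exact (monomialField_mem hm h0 h1 _ _ (by simpa [Finset.sum_add_distrib] using hd)).2

lemma toLp_mem_leadingFields {d : ℕ} {K : Fin n → EuclideanSpace ℂ (Fin n) → ℂ}
    (hK : ∀ i, K i ∈ HomPoly n (d + 2)) :
    (fun z => WithLp.toLp 2 fun i => K i z) ∈ leadingFields n k d := by
  have h1 : ∀ m, ∀ f ∈ HomPoly n (d + 2),
      (fun z => f z • EuclideanSpace.single m (1 : ℂ)) ∈ leadingFields n k d := by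
    intro m f hf
    induction hf using Submodule.span_induction with
    | mem x hx =>
      obtain ⟨α, hα, rfl⟩ := hx
      exact monomialFun_smul_mem hα m
    | zero =>
      convert (leadingFields n k d).zero_mem using 1
      funext z
      simp
    | add x y _ _ hx hy =>
      convert (leadingFields n k d).add_mem hx hy using 1
      funext z
      simp [add_smul]
    | smul a x _ hx =>
      convert (leadingFields n k d).smul_mem a hx using 1
      funext z
      simp [mul_smul]
  convert Submodule.sum_mem _ fun m (_ : m ∈ Finset.univ) => h1 m _ (hK m) using 1
  funext z
  ext i
  simp [Finset.sum_apply, Pi.single_apply]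

/-- Every invertible jet is realizable. -/
lemma exists_realizable_jet {Q : EuclideanSpace ℂ (Fin n) → EuclideanSpace ℂ (Fin n)}
    (hQ : Differentiable ℂ Q) (hQ0 : Q 0 = 0)
    {A : EuclideanSpace ℂ (Fin n) ≃L[ℂ] EuclideanSpace ℂ (Fin n)}
    (hA : fderiv ℂ Q 0 = (A : EuclideanSpace ℂ (Fin n) →L[ℂ] EuclideanSpace ℂ (Fin n))) (m : ℕ) :
    ∃ h, IsStdRealizable k h ∧ (fun z => h z - Q z) =O[𝓝 0] fun z => ‖z‖ ^ (m + 2) := by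
  have hQA : (fun z => Q z - A z) =O[𝓝 0] fun z => ‖z‖ ^ 2 := by
    simpa [hQ0, hA] using sub_fderiv_isBigO hQ
  induction m with
  | zero =>
    refine ⟨_, isStdRealizable_clm A, ?_⟩
    simpa using hQA.neg_left
  | succ m ih =>
    obtain ⟨h, hr, ho⟩ := ih
    have hAO : (fun z => A z) =O[𝓝 0] fun z => ‖z‖ :=
      ((A : EuclideanSpace ℂ (Fin n) →L[ℂ] EuclideanSpace ℂ (Fin n)).isBigO_id _).norm_right
    have hAsO : (fun z => A.symm z) =O[𝓝 0] fun z => ‖z‖ :=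
      ((A.symm : EuclideanSpace ℂ (Fin n) →L[ℂ] EuclideanSpace ℂ (Fin n)).isBigO_id _).norm_right
    have hDd : Differentiable ℂ fun z => Q (A.symm z) - h (A.symm z) :=
      (hQ.comp A.symm.differentiable).sub (hr.differentiable.comp A.symm.differentiable)
    have hDO : (fun z => Q (A.symm z) - h (A.symm z)) =O[𝓝 0] fun z => ‖z‖ ^ (m + 2) := by
      have := (ho.comp_tendsto (A.symm.continuous.tendsto' 0 0 (map_zero _))).trans
        (hAsO.norm_left.pow _)
      simpa [Function.comp_def] using this.neg_left
    have hcoord : ∀ i, ∃ K ∈ HomPoly n (m + 2),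
        (fun z => (Q (A.symm z) - h (A.symm z)) i - K z) =O[𝓝 0] fun z => ‖z‖ ^ (m + 3) :=
      fun i => exists_homPoly_sub_isBigO (m + 2) ((differentiable_coord i).comp hDd)
        ((IsBigO.of_bound 1 (Eventually.of_forall fun z => by
          simpa using PiLp.norm_apply_le (Q (A.symm z) - h (A.symm z)) i)).trans hDO)
    choose K₀ hK₀ hK₀O using hcoord
    set K : EuclideanSpace ℂ (Fin n) → EuclideanSpace ℂ (Fin n) :=
      fun z => WithLp.toLp 2 fun i => K₀ i z with hK
    obtain ⟨hKd, hKO, hKr⟩ := toLp_mem_leadingFields (k := k) hK₀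
    obtain ⟨e, her, heo⟩ := hKr 1
    have hKD : (fun z => Q (A.symm z) - h (A.symm z) - K z) =O[𝓝 0]
        fun z => ‖z‖ ^ (m + 3) := by
      have : (fun z => ∑ i, ((Q (A.symm z) - h (A.symm z)) i - K₀ i z) •
          EuclideanSpace.single i (1 : ℂ)) =O[𝓝 0] fun z => ‖z‖ ^ (m + 3) :=
        IsBigO.fun_sum fun i _ => by
          simpa using (hK₀O i).smul (isBigO_const_const (EuclideanSpace.single i (1 : ℂ))
            (one_ne_zero (α := ℝ)) (𝓝 0))
      refine this.congr_left fun z => ?_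
      ext i
      simp [hK, Finset.sum_apply, Pi.single_apply]
    have hhO : h =O[𝓝 0] fun z => ‖z‖ := by
      simpa [hr.map_zero] using sub_isBigO_norm_sub hr.differentiable 0
    have e1 : (fun z => e (h z) - h z - (1 : ℂ) • K (h z)) =O[𝓝 0] fun z => ‖z‖ ^ (m + 3) :=
      (heo.comp_tendsto (hr.differentiable.continuous.tendsto' 0 0 hr.map_zero)).trans
        (hhO.norm_left.pow _)
    have hhA : (fun z => h z - A z) =O[𝓝 0] fun z => ‖z‖ ^ 2 := by
      simpa using (ho.trans (isBigO_pow_of_le_zero (by omega : 2 ≤ m + 2))).add hQA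
    have e2 : (fun z => K (h z) - K (A z)) =O[𝓝 0] fun z => ‖z‖ ^ (m + 3) :=
      comp_sub_comp_isBigO hKd hKO hhO hAO hhA
    have e3 : (fun z => Q z - h z - K (A z)) =O[𝓝 0] fun z => ‖z‖ ^ (m + 3) := by
      have := (hKD.comp_tendsto (A.continuous.tendsto' 0 0 (map_zero _))).trans
        (hAO.norm_left.pow _)
      simpa [Function.comp_def] using this
    refine ⟨_, her.comp hr, ((e1.add e2).sub e3).congr_left fun z => ?_⟩
    simp only [one_smul]
    abel

end HigherOrder

/-! ### Limits of automorphisms -/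

section Limits

variable {E : Type*} [NormedAddCommGroup E] [NormedSpace ℂ E]

lemma IsAutPair.exists_hasFDerivAt {F G : E → E} (h : IsAutPair F G) (z : E) :
    ∃ A : E ≃L[ℂ] E, HasFDerivAt F (A : E →L[ℂ] E) z := by
  have hF := (h.left z).hasFDerivAt
  have hG := (h.right (F z)).hasFDerivAt
  have hF' := (h.left (G (F z))).hasFDerivAt
  have e1 : (fderiv ℂ G (F z)).comp (fderiv ℂ F z) = ContinuousLinearMap.id ℂ E :=
    ((hG.comp z hF).congr_of_eventuallyEq
      (Eventually.of_forall fun w => (h.right_left w).symm)).unique (hasFDerivAt_id z)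
  have e2 : (fderiv ℂ F z).comp (fderiv ℂ G (F z)) = ContinuousLinearMap.id ℂ E := by
    have := ((hF'.comp (F z) hG).congr_of_eventuallyEq
      (Eventually.of_forall fun w => (h.left_right w).symm)).unique (hasFDerivAt_id (F z))
    rwa [h.right_left] at this
  exact ⟨ContinuousLinearEquiv.equivOfInverse (fderiv ℂ F z) (fderiv ℂ G (F z))
    (fun v => DFunLike.congr_fun e1 v) (fun v => DFunLike.congr_fun e2 v), hF⟩

lemma exists_tendstoUniformlyOn_closedBall [CompleteSpace E] {f : ℕ → E → E}
    (h : ∀ s : ℕ, ∀ z ∈ closedBall (0 : E) s, ‖f (s + 1) z - f s z‖ ≤ (1 / 2) ^ s) :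
    ∃ g : E → E, ∀ R : ℝ, TendstoUniformlyOn f g atTop (closedBall 0 R) := by
  have hdist : ∀ (s : ℕ) (z : E), ‖z‖ ≤ s → ∀ l : ℕ,
      dist (f (l + s) z) (f (l + 1 + s) z) ≤ (1 / 2) ^ s * (1 / 2) ^ l := by
    intro s z hz l
    rw [dist_comm, dist_eq_norm, ← pow_add, add_comm s l, add_right_comm]
    refine h (l + s) z ?_
    rw [mem_closedBall_zero_iff]
    push_cast
    linarith [(Nat.cast_nonneg l : (0 : ℝ) ≤ l)]
  have hlim : ∀ z, ∃ w, Tendsto (fun s => f s z) atTop (𝓝 w) := by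
    intro z
    obtain ⟨s, hs⟩ := exists_nat_ge ‖z‖
    obtain ⟨w, hw⟩ := cauchySeq_tendsto_of_complete
      (cauchySeq_of_le_geometric _ _ one_half_lt_one (hdist s z hs))
    exact ⟨w, (tendsto_add_atTop_iff_nat s).1 hw⟩
  choose g hg using hlim
  refine ⟨g, fun R => Metric.tendstoUniformlyOn_iff.2 fun ε hε => ?_⟩
  obtain ⟨s₀, hs₀⟩ := exists_nat_ge R
  have h0 : Tendsto (fun s : ℕ => ((1 : ℝ) / 2) ^ s / (1 - 1 / 2)) atTop (𝓝 0) := by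
    simpa using (tendsto_pow_atTop_nhds_zero_of_lt_one (by norm_num : (0 : ℝ) ≤ 1 / 2)
      one_half_lt_one).div_const (1 - 1 / 2 : ℝ)
  filter_upwards [h0.eventually_lt_const hε, eventually_ge_atTop s₀] with s hs hs' z hz
  rw [mem_closedBall_zero_iff] at hz
  have hzs : ‖z‖ ≤ s := hz.trans (hs₀.trans (by exact_mod_cast hs'))
  rw [dist_comm]
  refine lt_of_le_of_lt ?_ hs
  simpa using dist_le_of_le_geometric_of_tendsto₀ (f := fun l => f (l + s) z) _ _ one_half_lt_one
    (hdist s z hzs) ((tendsto_add_atTop_iff_nat s).2 (hg z))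

lemma tendsto_comp_of_tendstoUniformlyOn_closedBall {f : ℕ → E → E} {g : E → E} (hg : Continuous g)
    (h : ∀ R : ℝ, TendstoUniformlyOn f g atTop (closedBall 0 R)) {u : ℕ → E} {w : E}
    (hu : Tendsto u atTop (𝓝 w)) : Tendsto (fun s => f s (u s)) atTop (𝓝 (g w)) := by
  have hmem : closedBall (0 : E) (‖w‖ + 1) ∈ 𝓝 w :=
    closedBall_mem_nhds_of_mem (by simp)
  refine (h (‖w‖ + 1)).tendsto_comp hg.continuousWithinAt ?_
  rwa [nhdsWithin_eq_nhds.2 hmem]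

lemma IsAutPair.of_tendstoUniformlyOn [CompleteSpace E] {f f' : ℕ → E → E} {g g' : E → E}
    (hf : ∀ s, IsAutPair (f s) (f' s))
    (h : ∀ R : ℝ, TendstoUniformlyOn f g atTop (closedBall 0 R))
    (h' : ∀ R : ℝ, TendstoUniformlyOn f' g' atTop (closedBall 0 R)) : IsAutPair g g' := by
  have hg := differentiable_of_tendstoUniformlyOn_closedBall (fun s => (hf s).left) h
  have hg' := differentiable_of_tendstoUniformlyOn_closedBall (fun s => (hf s).right) h'
  have hp : ∀ z, Tendsto (fun s => f s z) atTop (𝓝 (g z)) := fun z =>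
    (h ‖z‖).tendsto_at (by simp)
  have hp' : ∀ z, Tendsto (fun s => f' s z) atTop (𝓝 (g' z)) := fun z =>
    (h' ‖z‖).tendsto_at (by simp)
  refine ⟨hg, hg', fun z => ?_, fun z => ?_⟩
  · refine tendsto_nhds_unique
      (tendsto_comp_of_tendstoUniformlyOn_closedBall hg'.continuous h' (hp z)) ?_
    simp [(hf _).right_left]
  · refine tendsto_nhds_unique
      (tendsto_comp_of_tendstoUniformlyOn_closedBall hg.continuous h (hp' z)) ?_
    simp [(hf _).left_right]

lemma exists_forall_norm_comp_sub_le [ProperSpace E] {F G : E → E} (hG : Continuous G) {r k ε : ℝ}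
    (hε : 0 < ε) (hF : ∀ z ∈ closedBall (0 : E) r, F z ∈ closedBall (0 : E) k) :
    ∃ δ > 0, ∀ ψ ψ' : E → E, (∀ z ∈ closedBall (0 : E) k, ‖ψ z - z‖ ≤ δ) →
      (∀ z ∈ closedBall (0 : E) k, ‖ψ' z - z‖ ≤ δ) →
      (∀ z ∈ closedBall (0 : E) r, ‖ψ (F z) - F z‖ ≤ ε) ∧
      ∀ z ∈ closedBall (0 : E) k, ‖G (ψ' z) - G z‖ ≤ ε := by
  obtain ⟨δ, hδ, hGδ⟩ := Metric.uniformContinuousOn_iff_le.1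
    ((isCompact_closedBall (0 : E) (k + 1)).uniformContinuousOn_of_continuous hG.continuousOn) ε hε
  refine ⟨min (min δ ε) 1, by positivity, fun ψ ψ' h h' => ⟨fun z hz => ?_, fun z hz => ?_⟩⟩
  · exact (h _ (hF z hz)).trans ((min_le_left _ _).trans (min_le_right _ _))
  · have h1 := h' z hz
    have h2 : ‖ψ' z - z‖ ≤ 1 := h1.trans (min_le_right _ _)
    have h3 := norm_add_le (ψ' z - z) z
    rw [sub_add_cancel] at h3
    rw [mem_closedBall_zero_iff] at hz
    rw [← dist_eq_norm]
    refine hGδ _ (by rw [mem_closedBall_zero_iff]; linarith) _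
      (by rw [mem_closedBall_zero_iff]; linarith) ?_
    rw [dist_eq_norm]
    exact h1.trans ((min_le_left _ _).trans (min_le_left _ _))

lemma mem_closedBall_of_norm_sub_le {F F' : E → E} {r k k' ε : ℝ}
    (hF : ∀ z ∈ closedBall (0 : E) r, F z ∈ closedBall (0 : E) k)
    (h : ∀ z ∈ closedBall (0 : E) r, ‖F' z - F z‖ ≤ ε) (hk : k + ε ≤ k') :
    ∀ z ∈ closedBall (0 : E) r, F' z ∈ closedBall (0 : E) k' := by
  intro z hz
  have h1 := hF z hz
  have h2 := norm_add_le (F' z - F z) (F z)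
  rw [sub_add_cancel] at h2
  rw [mem_closedBall_zero_iff] at h1 ⊢
  linarith [h z hz]

end Limits

/-! ### The inductive construction -/

section Induction

variable {E : Type*} [NormedAddCommGroup E] [NormedSpace ℂ E]
  {St : (E → E) → (E → E) → ℕ → Prop}

/-- Given `St F G k` one can pass from `k` to `k + 1` changing `F` and `G` by arbitrarily little
on balls of radius `r` and `k`, provided that `F` maps the former into the latter. -/
def HasStep (St : (E → E) → (E → E) → ℕ → Prop) : Prop :=
  ∀ F G k (r : ℝ) (ε : ℝ), 0 < ε → St F G k →
    (∀ z ∈ closedBall (0 : E) r, F z ∈ closedBall (0 : E) k) →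
    ∃ F' G', St F' G' (k + 1) ∧ (∀ z ∈ closedBall (0 : E) r, ‖F' z - F z‖ ≤ ε) ∧
      ∀ z ∈ closedBall (0 : E) k, ‖G' z - G z‖ ≤ ε

lemma HasStep.add (hSt : HasStep St) (l : ℕ) : ∀ F G k (r : ℝ) (ε : ℝ), 0 < ε → St F G k →
    (∀ z ∈ closedBall (0 : E) r, F z ∈ closedBall (0 : E) k) →
    ∃ F' G', St F' G' (k + l) ∧ (∀ z ∈ closedBall (0 : E) r, ‖F' z - F z‖ ≤ ε) ∧
      ∀ z ∈ closedBall (0 : E) k, ‖G' z - G z‖ ≤ ε := by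
  induction l with
  | zero => exact fun F G k r ε hε h _ => ⟨F, G, h, by simp [hε.le], by simp [hε.le]⟩
  | succ l ih =>
    intro F G k r ε hε h hF
    obtain ⟨F₁, G₁, h₁, hF₁, hG₁⟩ := hSt F G k r (min (ε / 2) 1) (by positivity) h hF
    obtain ⟨F₂, G₂, h₂, hF₂, hG₂⟩ := ih F₁ G₁ (k + 1) r (ε / 2) (by positivity) h₁
      (mem_closedBall_of_norm_sub_le hF hF₁ (by push_cast; gcongr; exact min_le_right _ _))
    refine ⟨F₂, G₂, by rwa [add_assoc, add_comm 1 l] at h₂, fun z hz => ?_, fun z hz => ?_⟩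
    · have := norm_add_le (F₂ z - F₁ z) (F₁ z - F z)
      rw [sub_add_sub_cancel] at this
      linarith [hF₂ z hz, (hF₁ z hz).trans (min_le_left _ _)]
    · have := norm_add_le (G₂ z - G₁ z) (G₁ z - G z)
      rw [sub_add_sub_cancel] at this
      linarith [hG₂ z (closedBall_subset_closedBall (by push_cast; linarith) hz),
        (hG₁ z hz).trans (min_le_left _ _)]

variable [ProperSpace E]

lemma HasStep.exists_le (hSt : HasStep St) {F G : E → E} {k : ℕ} {r ε : ℝ} (hε : 0 < ε)
    (hε1 : ε ≤ 1) (h : St F G k) (hG : Continuous G)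
    (hF : ∀ z ∈ closedBall (0 : E) r, F z ∈ closedBall (0 : E) k) :
    ∃ F' G' k', k < k' ∧ St F' G' k' ∧ (∀ z ∈ closedBall (0 : E) r, ‖F' z - F z‖ ≤ ε) ∧
      (∀ z ∈ closedBall (0 : E) k, ‖G' z - G z‖ ≤ ε) ∧
      ∀ z ∈ closedBall (0 : E) k, G' z ∈ closedBall (0 : E) k' := by
  obtain ⟨M, -, hM⟩ := exists_norm_le_on_closedBall hG k
  obtain ⟨l, hl⟩ := exists_nat_ge M
  obtain ⟨F', G', h', hF', hG'⟩ := hSt.add (l + 1) F G k r ε hε h hF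
  refine ⟨F', G', _, by omega, h', hF', hG', mem_closedBall_of_norm_sub_le (k := M)
    (fun z hz => by simpa using hM z hz) hG' ?_⟩
  push_cast
  linarith [(Nat.cast_nonneg k : (0 : ℝ) ≤ k)]

lemma exists_cycle (h₁ : HasStep St) (h₂ : HasStep fun G F k => St F G k)
    (hc : ∀ F G k, St F G k → Continuous F ∧ Continuous G) {F G : E → E} {k r : ℕ} {ε : ℝ}
    (hε : 0 < ε) (hε1 : ε ≤ 1) (h : St F G k) (hrk : r ≤ k)
    (hF : ∀ z ∈ closedBall (0 : E) r, F z ∈ closedBall (0 : E) k) :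
    ∃ F' G' k' r', r < r' ∧ r' ≤ k' ∧ St F' G' k' ∧
      (∀ z ∈ closedBall (0 : E) r', F' z ∈ closedBall (0 : E) k') ∧
      (∀ z ∈ closedBall (0 : E) r, ‖F' z - F z‖ ≤ ε) ∧
      ∀ z ∈ closedBall (0 : E) r, ‖G' z - G z‖ ≤ ε := by
  obtain ⟨F₁, G₁, k₁, hk₁, s₁, hF₁, hG₁, hGb₁⟩ :=
    h₁.exists_le (ε := ε / 2) (by positivity) (by linarith) h (hc _ _ _ h).2 hF
  obtain ⟨G₂, F₂, k₂, hk₂, s₂, hG₂, hF₂, hFb₂⟩ :=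
    h₂.exists_le (ε := ε / 2) (by positivity) (by linarith) s₁ (hc _ _ _ s₁).1 hGb₁
  have hsub : closedBall (0 : E) r ⊆ closedBall (0 : E) k :=
    closedBall_subset_closedBall (by exact_mod_cast hrk)
  have hsub' : closedBall (0 : E) r ⊆ closedBall (0 : E) k₁ :=
    closedBall_subset_closedBall (by exact_mod_cast (by omega : r ≤ k₁))
  refine ⟨F₂, G₂, k₂, k₁, by omega, hk₂.le, s₂, hFb₂, fun z hz => ?_, fun z hz => ?_⟩
  · have := norm_add_le (F₂ z - F₁ z) (F₁ z - F z)
    rw [sub_add_sub_cancel] at this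
    linarith [hF₂ z (hsub' hz), hF₁ z hz]
  · have := norm_add_le (G₂ z - G₁ z) (G₁ z - G z)
    rw [sub_add_sub_cancel] at this
    linarith [hG₂ z (hsub hz), hG₁ z (hsub hz)]

lemma exists_limit_of_hasStep (h₁ : HasStep St) (h₂ : HasStep fun G F k => St F G k)
    (hc : ∀ F G k, St F G k → Continuous F ∧ Continuous G)
    (h0 : St (fun z => z) (fun z => z) 0) :
    ∃ (f f' : ℕ → E → E) (κ : ℕ → ℕ) (g g' : E → E), (∀ s, s ≤ κ s) ∧
      (∀ s, St (f s) (f' s) (κ s)) ∧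
      (∀ R : ℝ, TendstoUniformlyOn f g atTop (closedBall 0 R)) ∧
      ∀ R : ℝ, TendstoUniformlyOn f' g' atTop (closedBall 0 R) := by
  let X := {x : (E → E) × (E → E) × ℕ × ℕ // x.2.2.2 ≤ x.2.2.1 ∧ St x.1 x.2.1 x.2.2.1 ∧
    ∀ z ∈ closedBall (0 : E) x.2.2.2, x.1 z ∈ closedBall (0 : E) x.2.2.1}
  have hstep : ∀ (s : ℕ) (x : X), ∃ y : X, x.1.2.2.2 < y.1.2.2.2 ∧
      (∀ z ∈ closedBall (0 : E) x.1.2.2.2, ‖y.1.1 z - x.1.1 z‖ ≤ (1 / 2) ^ s) ∧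
      ∀ z ∈ closedBall (0 : E) x.1.2.2.2, ‖y.1.2.1 z - x.1.2.1 z‖ ≤ (1 / 2) ^ s := by
    rintro s ⟨⟨F, G, k, r⟩, hrk, h, hF⟩
    obtain ⟨F', G', k', r', e1, e2, e3, e4, e5, e6⟩ := exists_cycle h₁ h₂ hc
      (ε := (1 / 2) ^ s) (by positivity) (pow_le_one₀ (by norm_num) (by norm_num)) h hrk hF
    exact ⟨⟨(F', G', k', r'), e2, e3, e4⟩, e1, e5, e6⟩
  choose next hnext using hstep
  let x : ℕ → X := fun s => Nat.rec ⟨(fun z => z, fun z => z, 0, 0), le_rfl, h0, by simp⟩ next s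
  have hx : ∀ s, x (s + 1) = next s (x s) := fun s => rfl
  have hr : ∀ s, s ≤ (x s).1.2.2.2 := by
    intro s
    induction s with
    | zero => exact Nat.zero_le _
    | succ s ih =>
      have := (hnext s (x s)).1
      rw [hx]
      omega
  have hsub : ∀ s : ℕ, closedBall (0 : E) s ⊆ closedBall (0 : E) (x s).1.2.2.2 := fun s =>
    closedBall_subset_closedBall (by exact_mod_cast hr s)
  obtain ⟨g, hg⟩ := exists_tendstoUniformlyOn_closedBall (f := fun s => (x s).1.1)
    fun s z hz => (hnext s (x s)).2.1 z (hsub s hz)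
  obtain ⟨g', hg'⟩ := exists_tendstoUniformlyOn_closedBall (f := fun s => (x s).1.2.1)
    fun s z hz => (hnext s (x s)).2.2 z (hsub s hz)
  exact ⟨_, _, fun s => (x s).1.2.2.1, g, g', fun s => (hr s).trans (x s).2.1,
    fun s => (x s).2.2.1, hg, hg'⟩

end Induction

/-! ### Interpolation on the standard sequence -/

section Interpolation

variable {n : ℕ} [NeZero n]

lemma IsTameSequence.exists_isAutPair {a : ℕ → EuclideanSpace ℂ (Fin n)} (ha : IsTameSequence a) :
    ∃ Φ Φ', IsAutPair Φ Φ' ∧ ∀ j, Φ (a j) = stdPoint n j := by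
  obtain ⟨Φ, ⟨h1, Φ', h2, h3, h4⟩, h5⟩ := ha
  refine ⟨fun z => Φ z + EuclideanSpace.single 0 1, fun z => Φ' (z - EuclideanSpace.single 0 1),
    ⟨by fun_prop, by fun_prop, by simp [h3], by simp [h4]⟩, fun j => ?_⟩
  ext i
  rcases eq_or_ne i 0 with rfl | hi
  · simp [h5, stdPoint]
  · simp [h5, stdPoint, hi]

lemma differentiable_of_eval_mvPolynomial
    {P : EuclideanSpace ℂ (Fin n) → EuclideanSpace ℂ (Fin n)} {Q : Fin n → MvPolynomial (Fin n) ℂ}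
    (h : ∀ z i, P z i = MvPolynomial.eval (fun l => z l) (Q i)) : Differentiable ℂ P := by
  have hQ : ∀ q : MvPolynomial (Fin n) ℂ,
      Differentiable ℂ fun z : EuclideanSpace ℂ (Fin n) => MvPolynomial.eval (fun l => z l) q := by
    intro q
    induction q using MvPolynomial.induction_on with
    | C a => simp
    | add p q hp hq => simpa using hp.fun_add hq
    | mul_X p i hp => simpa using hp.fun_mul (differentiable_coord i)
  rw [differentiable_euclidean]
  intro i
  simpa only [h] using hQ (Q i)

variable [Nontrivial (Fin n)]

lemma exists_aut_jet {k : ℕ} {Q : EuclideanSpace ℂ (Fin n) → EuclideanSpace ℂ (Fin n)}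
    (hQ : Differentiable ℂ Q) (hQk : Q (stdPoint n k) = stdPoint n k)
    {A : EuclideanSpace ℂ (Fin n) ≃L[ℂ] EuclideanSpace ℂ (Fin n)}
    (hA : HasFDerivAt Q (A : EuclideanSpace ℂ (Fin n) →L[ℂ] EuclideanSpace ℂ (Fin n))
      (stdPoint n k)) (N : ℕ) {δ : ℝ} (hδ : 0 < δ) :
    ∃ ψ ψ', IsAutPair ψ ψ' ∧
      (∀ z ∈ closedBall (0 : EuclideanSpace ℂ (Fin n)) k, ‖ψ z - z‖ ≤ δ) ∧
      (∀ z ∈ closedBall (0 : EuclideanSpace ℂ (Fin n)) k, ‖ψ' z - z‖ ≤ δ) ∧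
      (∀ j ≠ k, JetEq (N + 1) (stdPoint n j) ψ fun z => z) ∧
      JetEq (N + 1) (stdPoint n k) ψ Q := by
  set c := stdPoint n k
  have hA0 : HasFDerivAt (fun z => Q (z + c) - c)
      (A : EuclideanSpace ℂ (Fin n) →L[ℂ] EuclideanSpace ℂ (Fin n)) 0 := by
    refine HasFDerivAt.sub_const c ?_
    rw [hasFDerivAt_comp_add_right, zero_add]
    exact hA
  obtain ⟨h, hr, ho⟩ := exists_realizable_jet (k := k) (Q := fun z => Q (z + c) - c)
    (by fun_prop) (by simp [hQk]) hA0.fderiv N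
  obtain ⟨ψ, ψ', h1, h2, h3, h4, h5⟩ := hr.exists_aut k (by linarith) δ hδ N
  refine ⟨ψ, ψ', h1, h2, h3, h4, h5.trans ?_⟩
  have := (ho.trans (isBigO_pow_of_le_zero (by omega : N + 1 ≤ N + 2))).comp_tendsto
    ((continuous_sub_right c).tendsto' c 0 (sub_self c))
  refine this.congr_left fun z => ?_
  simp only [Function.comp_apply, sub_add_cancel]
  abel

/-- `F` is an automorphism with inverse `G`, fixing the standard sequence, with the jets of `T` at
its first `k` points. -/
structure InterpolatesBelow (T : ℕ → EuclideanSpace ℂ (Fin n) → EuclideanSpace ℂ (Fin n))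
    (m : ℕ → ℕ) (F G : EuclideanSpace ℂ (Fin n) → EuclideanSpace ℂ (Fin n)) (k : ℕ) : Prop where
  isAutPair : IsAutPair F G
  map_stdPoint : ∀ j, F (stdPoint n j) = stdPoint n j
  jetEq : ∀ j < k, JetEq (m j + 1) (stdPoint n j) F (T j)

variable {T : ℕ → EuclideanSpace ℂ (Fin n) → EuclideanSpace ℂ (Fin n)} {m : ℕ → ℕ}

lemma InterpolatesBelow.inv_map_stdPoint {F G : EuclideanSpace ℂ (Fin n) → EuclideanSpace ℂ (Fin n)}
    {k : ℕ} (h : InterpolatesBelow T m F G k) (j : ℕ) : G (stdPoint n j) = stdPoint n j := by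
  conv_lhs => rw [← h.map_stdPoint j, h.isAutPair.right_left]

lemma hasStep_interpolatesBelow (hT : ∀ j, Differentiable ℂ (T j))
    (hTp : ∀ j, T j (stdPoint n j) = stdPoint n j)
    (hT' : ∀ j, ∃ A : EuclideanSpace ℂ (Fin n) ≃L[ℂ] EuclideanSpace ℂ (Fin n),
      HasFDerivAt (T j) (A : EuclideanSpace ℂ (Fin n) →L[ℂ] EuclideanSpace ℂ (Fin n))
        (stdPoint n j)) :
    HasStep (InterpolatesBelow T m) := by
  intro F G k r ε hε h hF
  have hGp := h.inv_map_stdPoint k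
  obtain ⟨δ, hδ, hδψ⟩ := exists_forall_norm_comp_sub_le h.isAutPair.right.continuous hε hF
  obtain ⟨A, hA⟩ := hT' k
  obtain ⟨B, hB⟩ := h.isAutPair.symm.exists_hasFDerivAt (stdPoint n k)
  rw [← hGp] at hA
  obtain ⟨ψ, ψ', hψ, hc, hc', hj, hk⟩ := exists_aut_jet (Q := fun z => T k (G z)) (A := B.trans A)
    ((hT k).comp h.isAutPair.right) (by rw [hGp, hTp]) (hA.comp _ hB)
    ((Finset.range (k + 1)).sup m) hδ
  have hm : ∀ j ≤ k, m j + 1 ≤ (Finset.range (k + 1)).sup m + 1 := fun j hjk =>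
    Nat.succ_le_succ (Finset.le_sup (Finset.mem_range.2 (by omega)))
  have hψp : ∀ j, ψ (stdPoint n j) = stdPoint n j := by
    intro j
    rcases eq_or_ne j k with rfl | hjk
    · rw [hk.eq, hGp, hTp]
    · exact (hj j hjk).eq
  refine ⟨fun z => ψ (F z), fun z => G (ψ' z), ⟨hψ.comp h.isAutPair, fun j => ?_, fun j hjk => ?_⟩,
    hδψ ψ ψ' hc hc'⟩
  · rw [h.map_stdPoint, hψp]
  · rcases (Nat.lt_succ_iff.1 hjk).eq_or_lt with rfl | hjk'
    · simpa only [h.isAutPair.right_left] using (hk.mono (hm j le_rfl)).comp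
        (JetEq.refl (m j + 1) (stdPoint n j) F) (h.map_stdPoint j) h.isAutPair.left
        h.isAutPair.left ((hT j).comp h.isAutPair.right)
    · exact (((hj j hjk'.ne).mono (hm j hjk'.le)).comp (JetEq.refl (m j + 1) (stdPoint n j) F)
        (h.map_stdPoint j) h.isAutPair.left h.isAutPair.left differentiable_id).trans
          (h.jetEq j hjk')

lemma hasStep_interpolatesBelow_swap (hT : ∀ j, Differentiable ℂ (T j))
    (hTp : ∀ j, T j (stdPoint n j) = stdPoint n j)
    (hT' : ∀ j, ∃ A : EuclideanSpace ℂ (Fin n) ≃L[ℂ] EuclideanSpace ℂ (Fin n),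
      HasFDerivAt (T j) (A : EuclideanSpace ℂ (Fin n) →L[ℂ] EuclideanSpace ℂ (Fin n))
        (stdPoint n j)) :
    HasStep fun G F k => InterpolatesBelow T m F G k := by
  intro G F k r ε hε h hG
  have hGp := h.inv_map_stdPoint k
  obtain ⟨δ, hδ, hδψ⟩ := exists_forall_norm_comp_sub_le h.isAutPair.left.continuous hε hG
  obtain ⟨A, hA⟩ := hT' k
  obtain ⟨B, hB⟩ := h.isAutPair.symm.exists_hasFDerivAt (stdPoint n k)
  rw [← hTp k] at hB
  obtain ⟨φ, φ', hφ, hc, hc', hj, hk⟩ := exists_aut_jet (Q := fun z => G (T k z)) (A := A.trans B)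
    (h.isAutPair.right.comp (hT k)) (by rw [hTp, hGp]) (HasFDerivAt.comp _ hB hA)
    ((Finset.range (k + 1)).sup m) hδ
  have hm : ∀ j ≤ k, m j + 1 ≤ (Finset.range (k + 1)).sup m + 1 := fun j hjk =>
    Nat.succ_le_succ (Finset.le_sup (Finset.mem_range.2 (by omega)))
  have hφp : ∀ j, φ (stdPoint n j) = stdPoint n j := by
    intro j
    rcases eq_or_ne j k with rfl | hjk
    · rw [hk.eq, hTp, hGp]
    · exact (hj j hjk).eq
  refine ⟨fun z => φ' (G z), fun z => F (φ z), ⟨h.isAutPair.comp hφ, fun j => ?_, fun j hjk => ?_⟩,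
    hδψ φ' φ hc' hc⟩
  · rw [hφp, h.map_stdPoint]
  · rcases (Nat.lt_succ_iff.1 hjk).eq_or_lt with rfl | hjk'
    · simpa only [h.isAutPair.left_right] using (JetEq.refl (m j + 1) (stdPoint n j) F).comp
        (hk.mono (hm j le_rfl)) (hφp j) hφ.left (h.isAutPair.right.comp (hT j)) h.isAutPair.left
    · exact (JetEq.comp (JetEq.refl (m j + 1) (stdPoint n j) F) ((hj j hjk'.ne).mono (hm j hjk'.le))
        (hφp j) hφ.left differentiable_id h.isAutPair.left).trans (h.jetEq j hjk')

/-- Interpolation of invertible jets on the standard sequence. -/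
lemma exists_isAutPair_jetEq (m : ℕ → ℕ) (hT : ∀ j, Differentiable ℂ (T j))
    (hTp : ∀ j, T j (stdPoint n j) = stdPoint n j)
    (hT' : ∀ j, ∃ A : EuclideanSpace ℂ (Fin n) ≃L[ℂ] EuclideanSpace ℂ (Fin n),
      HasFDerivAt (T j) (A : EuclideanSpace ℂ (Fin n) →L[ℂ] EuclideanSpace ℂ (Fin n))
        (stdPoint n j)) :
    ∃ F G, IsAutPair F G ∧ ∀ j, JetEq (m j + 1) (stdPoint n j) F (T j) := by
  obtain ⟨f, f', κ, g, g', hκ, hf, hg, hg'⟩ := exists_limit_of_hasStep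
    (hasStep_interpolatesBelow (m := m) hT hTp hT') (hasStep_interpolatesBelow_swap hT hTp hT')
    (fun F G k h => ⟨h.isAutPair.left.continuous, h.isAutPair.right.continuous⟩)
    ⟨IsAutPair.refl, fun _ => rfl, by simp⟩
  have hgg' := IsAutPair.of_tendstoUniformlyOn (fun s => (hf s).isAutPair) hg hg'
  refine ⟨g, g', hgg', fun j => ?_⟩
  refine isBigO_pow_of_tendstoUniformlyOn (f := fun s z => f s z - T j z)
    (fun s => (hf s).isAutPair.left.sub (hT j)) (hgg'.left.sub (hT j)).continuous (fun R => ?_) ?_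
  · refine Metric.tendstoUniformlyOn_iff.2 fun ε hε => ?_
    filter_upwards [Metric.tendstoUniformlyOn_iff.1 (hg R) ε hε] with s hs z hz
    simpa using hs z hz
  · filter_upwards [eventually_gt_atTop j] with s hs
    exact (hf s).jetEq j (hs.trans_le (hκ s))

end Interpolation

end Auxiliary

/-- Mittag-Leffler interpolation by automorphisms (Buzzard–Forstnerič): given tame discrete
sequences (a_j), (b_j) without repetitions and polynomial maps P_j with P_j(0) = 0 and
nondegenerate linear parts, there is an automorphism F of ℂⁿ with F(a_j) = b_j and
prescribed m_j-jet at each a_j. -/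
theorem automorphism_with_prescribed_jets_on_tame_sequence (n : ℕ) (hn : 2 ≤ n)
    (a b : ℕ → EuclideanSpace ℂ (Fin n))
    (ha_inj : Function.Injective a) (hb_inj : Function.Injective b)
    (ha_closed : IsClosed (Set.range a)) (hb_closed : IsClosed (Set.range b))
    (ha_disc : DiscreteTopology (Set.range a)) (hb_disc : DiscreteTopology (Set.range b))
    (ha_tame : IsTameSequence a) (hb_tame : IsTameSequence b)
    (m : ℕ → ℕ)
    (P : ℕ → EuclideanSpace ℂ (Fin n) → EuclideanSpace ℂ (Fin n))
    (hPpoly : ∀ j, ∃ Q : Fin n → MvPolynomial (Fin n) ℂ,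
      ∀ (z : EuclideanSpace ℂ (Fin n)) (i : Fin n),
        P j z i = MvPolynomial.eval (fun l => z l) (Q i))
    (hP0 : ∀ j, P j 0 = 0)
    (hPlin : ∀ j, ∃ A : EuclideanSpace ℂ (Fin n) ≃L[ℂ] EuclideanSpace ℂ (Fin n),
      fderiv ℂ (P j) 0 = (A : EuclideanSpace ℂ (Fin n) →L[ℂ] EuclideanSpace ℂ (Fin n))) :
    ∃ F : EuclideanSpace ℂ (Fin n) → EuclideanSpace ℂ (Fin n),
      IsHolomorphicAutomorphism F ∧
      ∀ j : ℕ, F (a j) = b j ∧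
        (fun z => F z - b j - P j (z - a j)) =O[nhds (a j)]
          (fun z => ‖z - a j‖ ^ (m j + 1)) := by
  have : NeZero n := ⟨by omega⟩
  have : Nontrivial (Fin n) := Fin.nontrivial_iff_two_le.2 hn
  obtain ⟨Φ, Φ', hΦ, hΦa⟩ := ha_tame.exists_isAutPair
  obtain ⟨Ψ, Ψ', hΨ, hΨb⟩ := hb_tame.exists_isAutPair
  have hΦp : ∀ j, Φ' (stdPoint n j) = a j := fun j => by rw [← hΦa, hΦ.right_left]
  have hP : ∀ j, Differentiable ℂ (P j) := fun j =>
    differentiable_of_eval_mvPolynomial (hPpoly j).choose_spec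
  have hJ : ∀ j, Differentiable ℂ fun z => b j + P j (z - a j) := fun j =>
    ((hP j).comp (differentiable_id.sub_const _)).const_add _
  have hJa : ∀ j, b j + P j (a j - a j) = b j := fun j => by simp [hP0]
  obtain ⟨F, G, hFG, hF⟩ := exists_isAutPair_jetEq
    (T := fun j z => Ψ (b j + P j (Φ' z - a j))) m
    (fun j => hΨ.left.comp ((hJ j).comp hΦ.right)) (fun j => by rw [hΦp, hJa, hΨb]) fun j => by
      obtain ⟨A, hA⟩ := hΦ.symm.exists_hasFDerivAt (stdPoint n j)
      obtain ⟨B, hB⟩ := hPlin j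
      obtain ⟨C, hC⟩ := hΨ.exists_hasFDerivAt (b j)
      have hB' : HasFDerivAt (fun z => b j + P j (z - a j))
          (B : EuclideanSpace ℂ (Fin n) →L[ℂ] EuclideanSpace ℂ (Fin n)) (a j) := by
        refine HasFDerivAt.const_add _ ?_
        rw [hasFDerivAt_comp_sub, sub_self, ← hB]
        exact (hP j 0).hasFDerivAt
      rw [← hJa j] at hC
      have hBC : HasFDerivAt (fun z => Ψ (b j + P j (z - a j)))
          ((B.trans C : EuclideanSpace ℂ (Fin n) ≃L[ℂ] EuclideanSpace ℂ (Fin n)) :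
            EuclideanSpace ℂ (Fin n) →L[ℂ] EuclideanSpace ℂ (Fin n)) (Φ' (stdPoint n j)) := by
        rw [hΦp]
        exact HasFDerivAt.comp (a j) hC hB'
      exact ⟨A.trans (B.trans C), HasFDerivAt.comp (stdPoint n j) hBC hA⟩
  have hFp : ∀ j, F (stdPoint n j) = stdPoint n j := fun j => by
    rw [(hF j).eq, hΦp, hJa, hΨb]
  have hfin := hΨ.symm.comp (hFG.comp hΦ)
  refine ⟨_, ⟨hfin.left, _, hfin.right, hfin.right_left, hfin.left_right⟩, fun j => ⟨?_, ?_⟩⟩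
  · rw [hΦa, hFp, ← hΨb, hΨ.right_left]
  · have hT : Differentiable ℂ fun z => Ψ (b j + P j (Φ' z - a j)) :=
      hΨ.left.comp ((hJ j).comp hΦ.right)
    have h1 := (hF j).comp (JetEq.refl (m j + 1) (a j) Φ) (hΦa j) hΦ.left hΦ.left hT
    have h2 := (JetEq.refl (m j + 1) (stdPoint n j) Ψ').comp h1 (by rw [hΦa, hFp])
      (hFG.left.comp hΦ.left) (hT.comp hΦ.left) hΨ.right
    simpa only [JetEq, hΨ.right_left, hΦ.right_left, sub_sub] using h2
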